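/- Let ℓ ≥ 2 and grade the v-deformed Fock space F_v by setting |λ⟩ in degree |λ| (the number of boxes of λ), so the degree-n component F_v^{(n)} is the finite-dimensional ℚ(v)-span of {|λ⟩ : |λ| = n}. Then the subspace {u ∈ F_v^{(n)} : E_ī u = 0 for all ī ∈ ℤ/ℓℤ} of highest weight vectors of degree n has ℚ(v)-dimension equal to the number of partitions of n/ℓ if ℓ divides n, and is zero if ℓ does not divide n. -/

import Mathlib

open scoped Classical

namespace MisraMiwa

/-- The content of a box `b = (i, j)` (row `i`, column `j`, indexed from 0): column minus row. -/
def content (b : ℕ × ℕ) : ℤ := (b.2 : ℤ) - (b.1 : ℤ)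

/-- The color of a box: its content modulo `ℓ`. -/
def color (ℓ : ℕ) (b : ℕ × ℕ) : ZMod ℓ := (content b : ZMod ℓ)

/-- `b` is an addable box of the partition (Young diagram) `μ`. -/
def IsAddable (μ : YoungDiagram) (b : ℕ × ℕ) : Prop :=
  b ∉ μ ∧ ∃ ν : YoungDiagram, (ν : Set (ℕ × ℕ)) = insert b (μ : Set (ℕ × ℕ))

/-- `b` is a removable box of the partition (Young diagram) `μ`. -/
def IsRemovable (μ : YoungDiagram) (b : ℕ × ℕ) : Prop :=
  b ∈ μ ∧ ∃ ν : YoungDiagram, (ν : Set (ℕ × ℕ)) = (μ : Set (ℕ × ℕ)) \ {b}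

/-- The partition obtained from `μ` by adding the addable box `b`. -/
noncomputable def added (μ : YoungDiagram) (b : ℕ × ℕ) : YoungDiagram :=
  if h : IsAddable μ b then h.2.choose else μ

/-- The partition obtained from `μ` by removing the removable box `b`. -/
noncomputable def erased (μ : YoungDiagram) (b : ℕ × ℕ) : YoungDiagram :=
  if h : IsRemovable μ b then h.2.choose else μ

/-- `A ℓ i μ` : the set of addable boxes of `μ` of color `i`. -/
def A (ℓ : ℕ) (i : ZMod ℓ) (μ : YoungDiagram) : Set (ℕ × ℕ) :=
  {b | IsAddable μ b ∧ color ℓ b = i}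

/-- `R ℓ i μ` : the set of removable boxes of `μ` of color `i`. -/
def R (ℓ : ℕ) (i : ZMod ℓ) (μ : YoungDiagram) : Set (ℕ × ℕ) :=
  {b | IsRemovable μ b ∧ color ℓ b = i}

/-- `Nc ℓ i μ = #A_i(μ) - #R_i(μ)`. -/
noncomputable def Nc (ℓ : ℕ) (i : ZMod ℓ) (μ : YoungDiagram) : ℤ :=
  ((A ℓ i μ).ncard : ℤ) - ((R ℓ i μ).ncard : ℤ)

/-- `b'` is to the left of `b` : its content is strictly larger. -/
def LeftOf (b' b : ℕ × ℕ) : Prop := content b < content b'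

/-- `b'` is to the right of `b` : its content is strictly smaller. -/
def RightOf (b' b : ℕ × ℕ) : Prop := content b' < content b

/-- `Nl ℓ i μ b` : number of removable boxes of `μ` of color `i` to the left of `b`
minus number of addable boxes of `μ` of color `i` to the left of `b`. -/
noncomputable def Nl (ℓ : ℕ) (i : ZMod ℓ) (μ : YoungDiagram) (b : ℕ × ℕ) : ℤ :=
  ({b' | b' ∈ R ℓ i μ ∧ LeftOf b' b}.ncard : ℤ) - ({b' | b' ∈ A ℓ i μ ∧ LeftOf b' b}.ncard : ℤ)

/-- `Nr ℓ i μ b` : as `Nl`, but to the right of `b`. -/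
noncomputable def Nr (ℓ : ℕ) (i : ZMod ℓ) (μ : YoungDiagram) (b : ℕ × ℕ) : ℤ :=
  ({b' | b' ∈ R ℓ i μ ∧ RightOf b' b}.ncard : ℤ) - ({b' | b' ∈ A ℓ i μ ∧ RightOf b' b}.ncard : ℤ)

/-- The `v`-deformed Fock space: the `ℚ(v)`-vector space with basis indexed by partitions. -/
abbrev Fock : Type := YoungDiagram →₀ RatFunc ℚ

/-- The indeterminate `v` of `ℚ(v)`. -/
noncomputable def v : RatFunc ℚ := RatFunc.X

/-- `E_i |λ⟩ = Σ_μ v^(-N^r_i(λ/μ)) |μ⟩`, sum over `μ ⊂ λ` with `λ/μ` one box of color `i`. -/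
noncomputable def Evec (ℓ : ℕ) (i : ZMod ℓ) (lam : YoungDiagram) : Fock :=
  ∑ᶠ b ∈ R ℓ i lam,
    v ^ (-Nr ℓ i (erased lam b) b) • Finsupp.single (erased lam b) (1 : RatFunc ℚ)

/-- `F_i |λ⟩ = Σ_μ v^(N^l_i(μ/λ)) |μ⟩`, sum over `μ ⊃ λ` with `μ/λ` one box of color `i`. -/
noncomputable def Fvec (ℓ : ℕ) (i : ZMod ℓ) (lam : YoungDiagram) : Fock :=
  ∑ᶠ b ∈ A ℓ i lam,
    v ^ (Nl ℓ i lam b) • Finsupp.single (added lam b) (1 : RatFunc ℚ)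

/-- The Misra–Miwa operator `E_i`. -/
noncomputable def Eop (ℓ : ℕ) (i : ZMod ℓ) : Fock →ₗ[RatFunc ℚ] Fock :=
  Finsupp.lsum (RatFunc ℚ) fun lam => LinearMap.toSpanSingleton (RatFunc ℚ) Fock (Evec ℓ i lam)

/-- The Misra–Miwa operator `F_i`. -/
noncomputable def Fop (ℓ : ℕ) (i : ZMod ℓ) : Fock →ₗ[RatFunc ℚ] Fock :=
  Finsupp.lsum (RatFunc ℚ) fun lam => LinearMap.toSpanSingleton (RatFunc ℚ) Fock (Fvec ℓ i lam)

/-- The Misra–Miwa operator `K_i` : `K_i |λ⟩ = v^(N_i(λ)) |λ⟩`. -/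
noncomputable def Kop (ℓ : ℕ) (i : ZMod ℓ) : Fock →ₗ[RatFunc ℚ] Fock :=
  Finsupp.lsum (RatFunc ℚ) fun lam =>
    LinearMap.toSpanSingleton (RatFunc ℚ) Fock (v ^ Nc ℓ i lam • Finsupp.single lam (1 : RatFunc ℚ))

/-- The inverse operator `K_i⁻¹ |λ⟩ = v^(-N_i(λ)) |λ⟩`. -/
noncomputable def Kinvop (ℓ : ℕ) (i : ZMod ℓ) : Fock →ₗ[RatFunc ℚ] Fock :=
  Finsupp.lsum (RatFunc ℚ) fun lam =>
    LinearMap.toSpanSingleton (RatFunc ℚ) Fock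
      (v ^ (-Nc ℓ i lam) • Finsupp.single lam (1 : RatFunc ℚ))

/-- The Cartan matrix entry of affine type `A^{(1)}_{ℓ-1}`. -/
noncomputable def cartan (ℓ : ℕ) (i j : ZMod ℓ) : ℤ :=
  2 * (if i = j then 1 else 0)
    - (({1, -1} : Finset ℤ).filter (fun e => j = i + (e : ZMod ℓ))).card

/-- The `q`-integer `[n] = (q^n - q^{-n})/(q - q⁻¹)` in `ℚ(q)` (here `q = v`). -/
noncomputable def qint (n : ℤ) : RatFunc ℚ := (v ^ n - v ^ (-n)) / (v - v⁻¹)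

/-- `hasVal p x n` : the nonzero rational function `x` has `p`-adic valuation `n`. -/
def hasVal (p : Polynomial ℚ) (x : RatFunc ℚ) (n : ℤ) : Prop :=
  ∃ a b : Polynomial ℚ, ¬ p ∣ a ∧ ¬ p ∣ b ∧
    x = algebraMap (Polynomial ℚ) (RatFunc ℚ) p ^ n *
        (algebraMap (Polynomial ℚ) (RatFunc ℚ) a / algebraMap (Polynomial ℚ) (RatFunc ℚ) b)

/-- Addable boxes of `μ` in rows strictly above row `k` (rows indexed from 0). -/
def Alt (μ : YoungDiagram) (k : ℕ) : Set (ℕ × ℕ) := {b | IsAddable μ b ∧ b.1 < k}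

/-- Removable boxes of `μ` in rows strictly above row `k` (rows indexed from 0). -/
def Rlt (μ : YoungDiagram) (k : ℕ) : Set (ℕ × ℕ) := {b | IsRemovable μ b ∧ b.1 < k}

/-- The degree-`n` component of Fock space: the span of `|λ⟩` for `|λ| = n`. -/
noncomputable def degComp (n : ℕ) : Submodule (RatFunc ℚ) Fock :=
  Submodule.span (RatFunc ℚ)
    {f | ∃ lam : YoungDiagram, lam.card = n ∧ f = Finsupp.single lam (1 : RatFunc ℚ)}


/-! ### Part 1: row lengths and Maya diagrams -/

theorem exists_of_rowLen (f : ℕ → ℕ) (hf : Antitone f) (N : ℕ) (hN : f N = 0) :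
    ∃ lam : YoungDiagram, ∀ j, lam.rowLen j = f j := by
  have hlow : IsLowerSet ((((Finset.range N) ×ˢ (Finset.range (f 0))).filter
      (fun p => p.2 < f p.1) : Finset (ℕ × ℕ)) : Set (ℕ × ℕ)) := by
    rintro ⟨a, b⟩ ⟨a', b'⟩ hab h
    simp only [Finset.coe_filter, Finset.mem_product, Finset.mem_range, Set.mem_setOf_eq] at h ⊢
    obtain ⟨h1, h2⟩ := Prod.mk_le_mk.1 hab
    have := hf h1
    omega
  refine ⟨⟨_, hlow⟩, ?_⟩
  · intro j
    have key : ∀ c, c < YoungDiagram.rowLen (⟨((Finset.range N) ×ˢ (Finset.range (f 0))).filter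
        (fun p => p.2 < f p.1), hlow⟩ : YoungDiagram) j ↔ c < f j := by
      intro c
      rw [← YoungDiagram.mem_iff_lt_rowLen, ← YoungDiagram.mem_cells]
      simp only [Finset.mem_filter, Finset.mem_product, Finset.mem_range]
      constructor
      · exact fun h => h.2
      · intro h
        refine ⟨⟨?_, ?_⟩, h⟩
        · by_contra hjN
          have := hf (not_lt.1 hjN)
          omega
        · have := hf (Nat.zero_le j)
          omega
    apply le_antisymm
    · by_contra h
      push Not at h
      exact lt_irrefl _ ((key _).1 h)
    · by_contra h
      push Not at h
      exact lt_irrefl _ ((key _).2 h)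

theorem yd_ext {μ ν : YoungDiagram} (h : ∀ j, μ.rowLen j = ν.rowLen j) : μ = ν := by
  apply YoungDiagram.ext
  ext ⟨a, b⟩
  rw [YoungDiagram.mem_cells, YoungDiagram.mem_cells, YoungDiagram.mem_iff_lt_rowLen,
    YoungDiagram.mem_iff_lt_rowLen, h]

/-- Position of the `j`-th particle. -/
def beta (μ : YoungDiagram) (j : ℕ) : ℤ := (μ.rowLen j : ℤ) - j

theorem beta_lt (μ : YoungDiagram) {j k : ℕ} (h : j < k) : beta μ k < beta μ j := by
  have := μ.rowLen_anti j k h.le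
  unfold beta; omega

theorem beta_inj (μ : YoungDiagram) {j k : ℕ} (h : beta μ j = beta μ k) : j = k := by
  rcases lt_trichotomy j k with h1 | h1 | h1
  · have := beta_lt μ h1; omega
  · exact h1
  · have := beta_lt μ h1; omega

/-- Occupation numbers of the Maya diagram. -/
noncomputable def occ (μ : YoungDiagram) (c : ℤ) : ℤ := if ∃ j, beta μ j = c then 1 else 0

theorem occ_one {μ : YoungDiagram} {c : ℤ} : occ μ c = 1 ↔ ∃ j, beta μ j = c := by
  unfold occ; split_ifs <;> simp_all

theorem occ_zero {μ : YoungDiagram} {c : ℤ} : occ μ c = 0 ↔ ¬ ∃ j, beta μ j = c := by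
  unfold occ; split_ifs <;> simp_all

theorem occ_bit (μ : YoungDiagram) (c : ℤ) : occ μ c = 0 ∨ occ μ c = 1 := by
  unfold occ; split_ifs <;> simp

theorem occ_inj {μ ν : YoungDiagram} (h : ∀ c, occ μ c = occ ν c) : μ = ν := by
  have key : ∀ (μ ν : YoungDiagram), (∀ c, occ μ c = occ ν c) → ∀ j,
      (∀ k < j, beta μ k = beta ν k) → beta μ j ≤ beta ν j := by
    intro μ ν h j ih
    have h1 : occ ν (beta μ j) = 1 := by rw [← h]; exact occ_one.2 ⟨j, rfl⟩
    obtain ⟨k, hk⟩ := occ_one.1 h1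
    rcases lt_trichotomy k j with h2 | h2 | h2
    · rw [← ih k h2] at hk
      exact absurd (beta_inj μ hk) (by omega)
    · rw [← hk, h2]
    · have := beta_lt ν h2; omega
  have hb : ∀ j, beta μ j = beta ν j := by
    intro j
    induction j using Nat.strong_induction_on with
    | _ j ih =>
      exact le_antisymm (key μ ν h j ih) (key ν μ (fun c => (h c).symm) j (fun k hk => (ih k hk).symm))
  apply yd_ext
  intro j
  have := hb j
  unfold beta at this; omega

/-- `ν` is `μ` with the box `b` added. -/
def Cov (μ ν : YoungDiagram) (b : ℕ × ℕ) : Prop :=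
  b ∉ μ ∧ (ν : Set (ℕ × ℕ)) = insert b (μ : Set (ℕ × ℕ))

theorem cov_mem {μ ν : YoungDiagram} {b : ℕ × ℕ} (h : Cov μ ν b) (x : ℕ × ℕ) :
    x ∈ ν ↔ x = b ∨ x ∈ μ := by
  have := Set.ext_iff.1 h.2 x
  simpa using this

theorem cov_rowLen {μ ν : YoungDiagram} {b : ℕ × ℕ} (h : Cov μ ν b) :
    b.2 = μ.rowLen b.1 ∧ ∀ j, ν.rowLen j = μ.rowLen j + if j = b.1 then 1 else 0 := by
  obtain ⟨r, s⟩ := b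
  have hm : ∀ j c, c < ν.rowLen j ↔ (j = r ∧ c = s) ∨ c < μ.rowLen j := by
    intro j c
    rw [← YoungDiagram.mem_iff_lt_rowLen, ← YoungDiagram.mem_iff_lt_rowLen, cov_mem h]
    simp
  have hnot : ¬ s < μ.rowLen r := fun hh => h.1 (YoungDiagram.mem_iff_lt_rowLen.2 hh)
  have h1 : s < ν.rowLen r := (hm r s).2 (Or.inl ⟨rfl, rfl⟩)
  have hs : s = μ.rowLen r := by
    by_contra hne
    have := (hm r (μ.rowLen r)).1 (by omega)
    omega
  refine ⟨hs, fun j => ?_⟩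
  simp only
  split_ifs with hj
  · subst hj
    have h2 := hm j (s + 1)
    omega
  · have h2 := hm j (μ.rowLen j)
    have h3 := hm j (ν.rowLen j)
    have h4 := hm j (ν.rowLen j - 1)
    omega

theorem cov_of_rowLen {μ ν : YoungDiagram} {r : ℕ}
    (h : ∀ j, ν.rowLen j = μ.rowLen j + if j = r then 1 else 0) : Cov μ ν (r, μ.rowLen r) := by
  refine ⟨fun hh => absurd (YoungDiagram.mem_iff_lt_rowLen.1 hh) (lt_irrefl _), ?_⟩
  ext ⟨j, c⟩
  have := h j
  simp only [SetLike.mem_coe, Set.mem_insert_iff, YoungDiagram.mem_iff_lt_rowLen, Prod.mk.injEq]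
  split_ifs at this with hj
  · subst hj; omega
  · omega

theorem cov_unique_right {μ ν ν' : YoungDiagram} {b : ℕ × ℕ} (h : Cov μ ν b) (h' : Cov μ ν' b) :
    ν = ν' := SetLike.coe_injective (h.2.trans h'.2.symm)

theorem cov_unique_left {μ μ' ν : YoungDiagram} {b : ℕ × ℕ} (h : Cov μ ν b) (h' : Cov μ' ν b) :
    μ = μ' := by
  apply yd_ext
  intro j
  have h1 := (cov_rowLen h).2 j
  have h2 := (cov_rowLen h').2 j
  omega

theorem cov_card {μ ν : YoungDiagram} {b : ℕ × ℕ} (h : Cov μ ν b) : ν.card = μ.card + 1 := by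
  have : ν.cells = insert b μ.cells := by
    ext x
    rw [Finset.mem_insert, YoungDiagram.mem_cells, YoungDiagram.mem_cells, cov_mem h]
  unfold YoungDiagram.card
  rw [this, Finset.card_insert_of_notMem]
  exact h.1

theorem isAddable_iff {μ : YoungDiagram} {b : ℕ × ℕ} : IsAddable μ b ↔ ∃ ν, Cov μ ν b :=
  ⟨fun h => ⟨h.2.choose, h.1, h.2.choose_spec⟩, fun ⟨ν, h⟩ => ⟨h.1, ν, h.2⟩⟩

theorem isRemovable_iff {ν : YoungDiagram} {b : ℕ × ℕ} : IsRemovable ν b ↔ ∃ μ, Cov μ ν b := by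
  constructor
  · rintro ⟨hb, μ, hμ⟩
    refine ⟨μ, ?_, ?_⟩
    · intro h
      have : b ∈ (μ : Set (ℕ × ℕ)) := h
      rw [hμ] at this
      exact this.2 rfl
    · rw [hμ, Set.insert_diff_singleton, Set.insert_eq_of_mem hb]
  · rintro ⟨μ, h⟩
    refine ⟨(cov_mem h b).2 (Or.inl rfl), μ, ?_⟩
    rw [h.2]
    ext x
    simp only [SetLike.mem_coe, Set.mem_diff, Set.mem_insert_iff, Set.mem_singleton_iff]
    constructor
    · intro hx
      exact ⟨Or.inr hx, fun hxb => h.1 (hxb ▸ hx)⟩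
    · tauto

theorem erased_eq {μ ν : YoungDiagram} {b : ℕ × ℕ} (h : Cov μ ν b) : erased ν b = μ := by
  have hr : IsRemovable ν b := isRemovable_iff.2 ⟨μ, h⟩
  unfold erased
  rw [dif_pos hr]
  have h1 := hr.2.choose_spec
  apply SetLike.coe_injective
  rw [h1, h.2]
  ext x
  simp only [SetLike.mem_coe, Set.mem_diff, Set.mem_insert_iff, Set.mem_singleton_iff]
  constructor
  · tauto
  · intro hx
    exact ⟨Or.inr hx, fun hxb => h.1 (hxb ▸ hx)⟩

theorem cov_content {μ ν : YoungDiagram} {b : ℕ × ℕ} (h : Cov μ ν b) :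
    content b = beta μ b.1 ∧ content b + 1 = beta ν b.1 := by
  obtain ⟨h1, h2⟩ := cov_rowLen h
  have := h2 b.1
  simp only [if_true] at this
  unfold content beta
  omega

theorem cov_beta_ne {μ ν : YoungDiagram} {b : ℕ × ℕ} (h : Cov μ ν b) {j : ℕ} (hj : j ≠ b.1) :
    beta ν j = beta μ j := by
  have := (cov_rowLen h).2 j
  simp only [if_neg hj] at this
  unfold beta
  omega

theorem cov_occ {μ ν : YoungDiagram} {b : ℕ × ℕ} (h : Cov μ ν b) (c : ℤ) :
    occ ν c = occ μ c - (if c = content b then 1 else 0) + (if c = content b + 1 then 1 else 0) := by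
  obtain ⟨h1, h2⟩ := cov_content h
  have hμ0 : occ μ (content b + 1) = 0 := by
    rw [occ_zero]
    rintro ⟨j, hj⟩
    by_cases hjb : j = b.1
    · subst hjb; omega
    · rw [← cov_beta_ne h hjb, h2] at hj
      exact hjb (beta_inj ν hj)
  have hν0 : occ ν (content b) = 0 := by
    rw [occ_zero]
    rintro ⟨j, hj⟩
    by_cases hjb : j = b.1
    · subst hjb; omega
    · rw [cov_beta_ne h hjb, h1] at hj
      exact hjb (beta_inj μ hj)
  have hμ1 : occ μ (content b) = 1 := occ_one.2 ⟨_, h1.symm⟩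
  have hν1 : occ ν (content b + 1) = 1 := occ_one.2 ⟨_, h2.symm⟩
  by_cases hc : c = content b
  · subst hc; rw [hν0, hμ1]; simp
  by_cases hc' : c = content b + 1
  · subst hc'; rw [hν1, hμ0]; simp
  rw [if_neg hc, if_neg hc']
  have : (∃ j, beta ν j = c) ↔ (∃ j, beta μ j = c) := by
    constructor
    · rintro ⟨j, hj⟩
      by_cases hjb : j = b.1
      · subst hjb; omega
      · exact ⟨j, by rw [← cov_beta_ne h hjb, hj]⟩
    · rintro ⟨j, hj⟩
      by_cases hjb : j = b.1
      · subst hjb; omega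
      · exact ⟨j, by rw [cov_beta_ne h hjb, hj]⟩
  unfold occ
  simp [this]

theorem cov_occ_vals {μ ν : YoungDiagram} {b : ℕ × ℕ} (h : Cov μ ν b) :
    occ μ (content b) = 1 ∧ occ μ (content b + 1) = 0 ∧
    occ ν (content b) = 0 ∧ occ ν (content b + 1) = 1 := by
  have h1 := cov_occ h (content b)
  have h2 := cov_occ h (content b + 1)
  obtain ⟨h3, h4⟩ := cov_content h
  have hμ1 : occ μ (content b) = 1 := occ_one.2 ⟨_, h3.symm⟩
  have hν1 : occ ν (content b + 1) = 1 := occ_one.2 ⟨_, h4.symm⟩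
  simp at h1 h2
  omega

theorem eventually_rowLen_zero (μ : YoungDiagram) : ∃ N, μ.rowLen N = 0 := by
  refine ⟨μ.colLen 0, ?_⟩
  by_contra h
  have : (μ.colLen 0, 0) ∈ μ := YoungDiagram.mem_iff_lt_rowLen.2 (by omega)
  exact absurd (YoungDiagram.mem_iff_lt_colLen.1 this) (lt_irrefl _)

theorem exists_up {μ : YoungDiagram} {c : ℤ} (h1 : occ μ c = 1) (h0 : occ μ (c + 1) = 0) :
    ∃ ν b, Cov μ ν b ∧ content b = c := by
  obtain ⟨r, hr⟩ := occ_one.1 h1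
  rw [occ_zero] at h0
  obtain ⟨N, hN⟩ := eventually_rowLen_zero μ
  obtain ⟨ν, hν⟩ := exists_of_rowLen (fun j => μ.rowLen j + if j = r then 1 else 0) (by
    apply antitone_nat_of_succ_le
    intro j
    have := μ.rowLen_anti j (j + 1) (Nat.le_succ j)
    by_cases hj : j + 1 = r
    · have h2 : beta μ j ≠ c + 1 := fun hh => h0 ⟨j, hh⟩
      subst hj
      unfold beta at h2 hr
      simp only [if_true]
      push_cast at hr
      split_ifs <;> omega
    · simp only [if_neg hj]; omega) (N + r + 1) (by
    have := μ.rowLen_anti N (N + r + 1) (by omega)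
    rw [if_neg (by omega)]
    omega)
  refine ⟨ν, _, cov_of_rowLen hν, ?_⟩
  exact hr

theorem exists_dn {ν : YoungDiagram} {c : ℤ} (h0 : occ ν c = 0) (h1 : occ ν (c + 1) = 1) :
    ∃ μ b, Cov μ ν b ∧ content b = c := by
  obtain ⟨r, hr⟩ := occ_one.1 h1
  rw [occ_zero] at h0
  obtain ⟨N, hN⟩ := eventually_rowLen_zero ν
  have hlt : ν.rowLen (r + 1) < ν.rowLen r := by
    have := ν.rowLen_anti r (r + 1) (Nat.le_succ r)
    have h2 : beta ν (r + 1) ≠ c := fun hh => h0 ⟨_, hh⟩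
    unfold beta at h2 hr
    push_cast at h2
    omega
  obtain ⟨μ, hμ⟩ := exists_of_rowLen (fun j => ν.rowLen j - if j = r then 1 else 0) (by
    apply antitone_nat_of_succ_le
    intro j
    have := ν.rowLen_anti j (j + 1) (Nat.le_succ j)
    by_cases hj : j = r
    · subst hj; simp; omega
    · simp only [if_neg hj]; omega) N (by simp [hN])
  have hc : Cov μ ν (r, μ.rowLen r) := cov_of_rowLen (by
    intro j
    rw [hμ]
    split_ifs with hj
    · subst hj; omega
    · omega)
  refine ⟨μ, _, hc, ?_⟩
  have := (cov_content hc).2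
  simp only at this
  rw [hr] at this
  omega

theorem cov_of_occ {μ ν : YoungDiagram} {c : ℤ} (h1 : occ μ c = 1) (h0 : occ μ (c + 1) = 0)
    (h : ∀ x, occ ν x = occ μ x - (if x = c then 1 else 0) + (if x = c + 1 then 1 else 0)) :
    ∃ b, Cov μ ν b ∧ content b = c := by
  obtain ⟨ν', b, hb, hc⟩ := exists_up h1 h0
  have : ν' = ν := by
    apply occ_inj
    intro x
    rw [h, cov_occ hb, hc]
  subst this
  exact ⟨b, hb, hc⟩

theorem cov_box_eq {μ ν μ' ν' : YoungDiagram} {b b' : ℕ × ℕ} (h : Cov μ ν b) (h' : Cov μ' ν' b')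
    (hc : content b = content b') (heq : μ = μ' ∨ ν = ν') : b = b' := by
  have e1 := (cov_rowLen h)
  have e2 := (cov_rowLen h')
  have c1 := cov_content h
  have c2 := cov_content h'
  have hr : b.1 = b'.1 := by
    rcases heq with rfl | rfl
    · apply beta_inj μ; rw [← c1.1, ← c2.1, hc]
    · apply beta_inj ν; rw [← c1.2, ← c2.2, hc]
  unfold content at hc
  exact Prod.ext hr (by omega)

/-- The partition with one particle moved from `c` to `c+1`. -/
noncomputable def up (μ : YoungDiagram) (c : ℤ) : YoungDiagram :=
  if h : ∃ ν b, Cov μ ν b ∧ content b = c then h.choose else μ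

/-- The partition with one particle moved from `c+1` to `c`. -/
noncomputable def dn (ν : YoungDiagram) (c : ℤ) : YoungDiagram :=
  if h : ∃ μ b, Cov μ ν b ∧ content b = c then h.choose else ν

theorem up_eq {μ ν : YoungDiagram} {b : ℕ × ℕ} (h : Cov μ ν b) : up μ (content b) = ν := by
  have hh : ∃ ν' b', Cov μ ν' b' ∧ content b' = content b := ⟨ν, b, h, rfl⟩
  unfold up
  rw [dif_pos hh]
  obtain ⟨b', h1, h2⟩ := hh.choose_spec
  have := cov_box_eq h h1 h2.symm (Or.inl rfl)
  subst this
  exact (cov_unique_right h h1).symm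

theorem dn_eq {μ ν : YoungDiagram} {b : ℕ × ℕ} (h : Cov μ ν b) : dn ν (content b) = μ := by
  have hh : ∃ μ' b', Cov μ' ν b' ∧ content b' = content b := ⟨μ, b, h, rfl⟩
  unfold dn
  rw [dif_pos hh]
  obtain ⟨b', h1, h2⟩ := hh.choose_spec
  have := cov_box_eq h h1 h2.symm (Or.inr rfl)
  subst this
  exact (cov_unique_left h h1).symm

theorem mem_card {μ : YoungDiagram} {a b : ℕ} (h : (a, b) ∈ μ) : a + b < μ.card := by
  have hsub : ((Finset.range (a + 1)).image (fun x => (x, 0)) ∪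
      (Finset.range b).image (fun x => (a, x + 1))) ⊆ μ.cells := by
    intro x hx
    rw [YoungDiagram.mem_cells]
    simp only [Finset.mem_union, Finset.mem_image, Finset.mem_range] at hx
    rcases hx with ⟨y, hy, rfl⟩ | ⟨y, hy, rfl⟩
    · exact μ.up_left_mem (by omega) (by omega) h
    · exact μ.up_left_mem (by omega) (by omega) h
  have h2 := Finset.card_le_card hsub
  rw [Finset.card_union_of_disjoint, Finset.card_image_of_injective,
    Finset.card_image_of_injective, Finset.card_range, Finset.card_range] at h2
  · unfold YoungDiagram.card; omega
  · intro x y hxy; simpa using hxy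
  · intro x y hxy; simpa using hxy
  · rw [Finset.disjoint_left]
    intro x hx hx'
    simp only [Finset.mem_image, Finset.mem_range] at hx hx'
    obtain ⟨y, hy, rfl⟩ := hx
    obtain ⟨z, hz, hz'⟩ := hx'
    simp at hz'

theorem rowLen_le_card {μ : YoungDiagram} (j : ℕ) : μ.rowLen j ≤ μ.card - j := by
  by_contra h
  have : (j, μ.rowLen j - 1) ∈ μ := YoungDiagram.mem_iff_lt_rowLen.2 (by omega)
  have := mem_card this
  omega

theorem occ_low {μ : YoungDiagram} {k : ℕ} (h : μ.rowLen k = 0) {c : ℤ} (hc : c ≤ -k) :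
    occ μ c = 1 := by
  rw [occ_one]
  refine ⟨(-c).toNat, ?_⟩
  have := μ.rowLen_anti k (-c).toNat (by omega)
  unfold beta; omega

theorem occ_low_card {μ : YoungDiagram} {n : ℕ} (h : μ.card ≤ n) {c : ℤ} (hc : c ≤ -n) :
    occ μ c = 1 := by
  refine occ_low (k := n) ?_ hc
  have := @rowLen_le_card μ n
  omega

theorem occ_high_card {μ : YoungDiagram} {n : ℕ} (h : μ.card ≤ n) {c : ℤ} (hc : n < c) :
    occ μ c = 0 := by
  rw [occ_zero]
  rintro ⟨j, hj⟩
  have := @rowLen_le_card μ j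
  unfold beta at hj
  omega

theorem card_eq_sum {μ : YoungDiagram} {n : ℕ} (h : μ.rowLen n = 0) :
    μ.card = ∑ j ∈ Finset.range n, μ.rowLen j := by
  have h1 : μ.cells = (Finset.range n).biUnion (fun j => (Finset.range (μ.rowLen j)).image
      (fun c => (j, c))) := by
    ext ⟨a, b⟩
    rw [YoungDiagram.mem_cells, YoungDiagram.mem_iff_lt_rowLen]
    simp only [Finset.mem_biUnion, Finset.mem_image, Finset.mem_range, Prod.mk.injEq]
    constructor
    · intro hab
      refine ⟨a, ?_, b, hab, rfl, rfl⟩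
      by_contra hn
      have := μ.rowLen_anti n a (by omega)
      omega
    · rintro ⟨j, hj, c, hc, rfl, rfl⟩
      exact hc
  unfold YoungDiagram.card
  rw [h1, Finset.card_biUnion]
  · apply Finset.sum_congr rfl
    intro j _
    rw [Finset.card_image_of_injective, Finset.card_range]
    intro x y hxy
    simpa using hxy
  · intro x _ y _ hxy
    simp only [Function.onFun]
    rw [Finset.disjoint_left]
    intro z hz hz'
    simp only [Finset.mem_image, Finset.mem_range] at hz hz'
    obtain ⟨_, _, rfl⟩ := hz
    obtain ⟨_, _, h2⟩ := hz'
    simp at h2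
    exact hxy h2.1.symm

/-- sums over particles as sums over sites -/
theorem sum_occ (g : ℤ → ℤ) {μ : YoungDiagram} {n : ℕ} {L : ℤ} (h : μ.rowLen n = 0)
    (hL : (μ.rowLen 0 : ℤ) ≤ L) :
    ∑ c ∈ Finset.Ioc (-n : ℤ) L, g c * occ μ c = ∑ j ∈ Finset.range n, g (beta μ j) := by
  rw [← Finset.sum_subset (s₁ := (Finset.range n).image (beta μ))]
  · rw [Finset.sum_image (fun x _ y _ hxy => beta_inj μ hxy)]
    apply Finset.sum_congr rfl
    intro j _
    rw [occ_one.2 ⟨j, rfl⟩, mul_one]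
  · intro c hc
    simp only [Finset.mem_image, Finset.mem_range] at hc
    obtain ⟨j, hj, rfl⟩ := hc
    have := μ.rowLen_anti 0 j (by omega)
    rw [Finset.mem_Ioc]
    unfold beta
    omega
  · intro c hc hc'
    have : occ μ c = 0 := by
      rw [occ_zero]
      rintro ⟨j, hj⟩
      apply hc'
      rw [Finset.mem_image]
      refine ⟨j, ?_, hj⟩
      rw [Finset.mem_range]
      by_contra hn
      have h1 := μ.rowLen_anti n j (by omega)
      rw [Finset.mem_Ioc] at hc
      unfold beta at hj
      omega
    rw [this, mul_zero]

theorem finite_card (n : ℕ) : {μ : YoungDiagram | μ.card = n}.Finite := by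
  apply Set.Finite.of_finite_image (f := YoungDiagram.cells)
  · apply Set.Finite.subset (Finset.finite_toSet
      ((Finset.range n ×ˢ Finset.range n).powerset))
    rintro _ ⟨μ, hμ, rfl⟩
    simp only [Finset.mem_coe, Finset.mem_powerset]
    rintro ⟨a, b⟩ hab
    have := mem_card ((YoungDiagram.mem_cells _).1 hab)
    simp only [Set.mem_setOf_eq] at hμ
    simp
    omega
  · intro μ _ ν _ h
    exact YoungDiagram.ext h

/-- The finite set of partitions of size `n`. -/
noncomputable def ydn (n : ℕ) : Finset YoungDiagram := (finite_card n).toFinset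

theorem mem_ydn {n : ℕ} {μ : YoungDiagram} : μ ∈ ydn n ↔ μ.card = n := by
  unfold ydn; simp

/-! ### Part 2: the operators in terms of Maya diagrams -/

theorem cov_unique_box {μ ν : YoungDiagram} {b b' : ℕ × ℕ} (h : Cov μ ν b) (h' : Cov μ ν b') :
    b = b' := by
  have h1 : b ∈ ν := (cov_mem h b).2 (Or.inl rfl)
  rcases (cov_mem h' b).1 h1 with h2 | h2
  · exact h2
  · exact absurd h2 h.1

/-- the `t`-th content of color `i` -/
def lev (ℓ : ℕ) (i : ZMod ℓ) (N : ℕ) (t : ℕ) : ℤ := (i.val : ℤ) - ℓ * N + ℓ * t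

theorem lev_inj {ℓ : ℕ} (hℓ : 2 ≤ ℓ) {i : ZMod ℓ} {N s t : ℕ} (h : lev ℓ i N s = lev ℓ i N t) :
    s = t := by
  unfold lev at h
  have h1 : (ℓ : ℤ) * s = ℓ * t := by linarith
  have h2 : (ℓ : ℤ) ≠ 0 := by omega
  exact_mod_cast mul_left_cancel₀ h2 h1

theorem lev_lt {ℓ : ℕ} (hℓ : 2 ≤ ℓ) {i : ZMod ℓ} {N s t : ℕ} :
    lev ℓ i N s < lev ℓ i N t ↔ s < t := by
  unfold lev
  have h2 : (0 : ℤ) < ℓ := by omega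
  constructor
  · intro h
    have h1 : (ℓ : ℤ) * s < ℓ * t := by linarith
    exact_mod_cast lt_of_mul_lt_mul_left h1 h2.le
  · intro h
    have : (ℓ : ℤ) * s < ℓ * t := by
      apply mul_lt_mul_of_pos_left _ h2
      exact_mod_cast h
    linarith

theorem lev_color {ℓ : ℕ} (hℓ : 2 ≤ ℓ) (i : ZMod ℓ) (N t : ℕ) : ((lev ℓ i N t : ℤ) : ZMod ℓ) = i := by
  haveI : NeZero ℓ := ⟨by omega⟩
  unfold lev
  push_cast
  simp

theorem exists_lev {ℓ : ℕ} (hℓ : 2 ≤ ℓ) {i : ZMod ℓ} {N : ℕ} {c : ℤ} (hc : (c : ZMod ℓ) = i)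
    (h1 : -(N : ℤ) < c) (h2 : c < N) : ∃ t, t < 2 * N ∧ lev ℓ i N t = c := by
  haveI : NeZero ℓ := ⟨by omega⟩
  have hlt : i.val < ℓ := ZMod.val_lt i
  have hd : (ℓ : ℤ) ∣ c - i.val := by
    rw [← ZMod.intCast_zmod_eq_zero_iff_dvd]
    push_cast
    simp [hc]
  obtain ⟨k, hk⟩ := hd
  have hℓ' : (2 : ℤ) ≤ ℓ := by exact_mod_cast hℓ
  have hlt' : (i.val : ℤ) < ℓ := by exact_mod_cast hlt
  have hk1 : -(N : ℤ) ≤ k := by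
    by_contra hh
    push Not at hh
    have : (ℓ : ℤ) * (k + 1) ≤ ℓ * (-N) := by
      apply mul_le_mul_of_nonneg_left _ (by omega)
      omega
    have h3 : (ℓ : ℤ) * N ≥ 1 * N := mul_le_mul_of_nonneg_right (by omega) (by omega)
    nlinarith
  have hk2 : k < (N : ℤ) := by
    by_contra hh
    push Not at hh
    have : (ℓ : ℤ) * N ≤ ℓ * k := by
      apply mul_le_mul_of_nonneg_left _ (by omega)
      omega
    have h3 : (ℓ : ℤ) * N ≥ 1 * N := mul_le_mul_of_nonneg_right (by omega) (by omega)
    have : (0 : ℤ) ≤ i.val := by omega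
    nlinarith
  refine ⟨(k + N).toNat, by omega, ?_⟩
  unfold lev
  rw [Int.toNat_of_nonneg (by omega)]
  linarith

/-- content `c` addable -/
def Ad (μ : YoungDiagram) (c : ℤ) : Prop := occ μ c = 1 ∧ occ μ (c + 1) = 0

/-- content `c` removable -/
def Rm (μ : YoungDiagram) (c : ℤ) : Prop := occ μ c = 0 ∧ occ μ (c + 1) = 1

theorem ad_iff {μ : YoungDiagram} {c : ℤ} : Ad μ c ↔ ∃ ν b, Cov μ ν b ∧ content b = c := by
  constructor
  · rintro ⟨h1, h2⟩
    exact exists_up h1 h2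
  · rintro ⟨ν, b, h, rfl⟩
    have := cov_occ_vals h
    exact ⟨this.1, this.2.1⟩

theorem rm_iff {ν : YoungDiagram} {c : ℤ} : Rm ν c ↔ ∃ μ b, Cov μ ν b ∧ content b = c := by
  constructor
  · rintro ⟨h1, h2⟩
    exact exists_dn h1 h2
  · rintro ⟨ν, b, h, rfl⟩
    have := cov_occ_vals h
    exact ⟨this.2.2.1, this.2.2.2⟩

theorem ad_bound {μ : YoungDiagram} {c : ℤ} {n : ℕ} (hn : μ.card ≤ n) (h : Ad μ c) :
    -(n : ℤ) ≤ c ∧ c ≤ n := by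
  constructor
  · by_contra hh
    have := occ_low_card hn (c := c + 1) (by omega)
    have := h.2
    omega
  · by_contra hh
    have := occ_high_card hn (c := c) (by omega)
    have := h.1
    omega

theorem rm_bound {μ : YoungDiagram} {c : ℤ} {n : ℕ} (hn : μ.card ≤ n) (h : Rm μ c) :
    -(n : ℤ) ≤ c ∧ c ≤ n := by
  constructor
  · by_contra hh
    have := occ_low_card hn (c := c) (by omega)
    have := h.1
    omega
  · by_contra hh
    have := occ_high_card hn (c := c + 1) (by omega)
    have := h.2
    omega

/-- partial sums of the signature -/
noncomputable def hgt (ℓ : ℕ) (i : ZMod ℓ) (N : ℕ) (μ : YoungDiagram) (t : ℕ) : ℤ :=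
  ∑ s ∈ Finset.range t, (occ μ (lev ℓ i N s) - occ μ (lev ℓ i N s + 1))

theorem ncard_lev {ℓ : ℕ} (hℓ : 2 ≤ ℓ) {i : ZMod ℓ} {N t : ℕ} {X : Set (ℕ × ℕ)} {P : ℤ → Prop}
    (hinj : ∀ b ∈ X, ∀ b' ∈ X, content b = content b' → b = b')
    (hX : ∀ c, (∃ b ∈ X, content b = c) ↔ (P c ∧ (c : ZMod ℓ) = i ∧ c < lev ℓ i N t))
    (hP : ∀ c, P c → -(N : ℤ) < c ∧ c < N) :
    X.ncard = ((Finset.range t).filter (fun s => P (lev ℓ i N s))).card := by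
  have h1 : (content '' X).ncard = X.ncard := Set.ncard_image_of_injOn (fun b hb b' hb' h =>
    hinj b hb b' hb' h)
  have h2 : content '' X =
      (((Finset.range t).filter (fun s => P (lev ℓ i N s))).image (lev ℓ i N) : Finset ℤ) := by
    ext c
    simp only [Set.mem_image, Finset.coe_image, Finset.coe_filter, Finset.mem_range,
      Set.mem_ofPred_eq]
    rw [hX c]
    constructor
    · rintro ⟨hp, hc, hlt⟩
      obtain ⟨s, _, rfl⟩ := exists_lev hℓ hc (hP c hp).1 (hP c hp).2
      exact ⟨s, ⟨(lev_lt hℓ).1 hlt, hp⟩, rfl⟩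
    · rintro ⟨s, ⟨hs, hp⟩, rfl⟩
      exact ⟨hp, lev_color hℓ _ _ _, (lev_lt hℓ).2 hs⟩
  rw [← h1, h2, Set.ncard_coe_finset, Finset.card_image_of_injective]
  intro x y hxy
  exact lev_inj hℓ hxy

theorem Nr_eq {ℓ : ℕ} (hℓ : 2 ≤ ℓ) {i : ZMod ℓ} {N t : ℕ} {μ : YoungDiagram} {b : ℕ × ℕ}
    (hN : μ.card < N) (hb : content b = lev ℓ i N t) :
    -Nr ℓ i μ b = hgt ℓ i N μ t := by
  unfold Nr
  rw [ncard_lev (i := i) (N := N) (t := t) (P := Rm μ) hℓ, ncard_lev (i := i) (N := N) (t := t) (P := Ad μ) hℓ]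
  · rw [Finset.card_filter, Finset.card_filter]
    push_cast
    rw [neg_sub, ← Finset.sum_sub_distrib]
    apply Finset.sum_congr rfl
    intro s _
    unfold Ad Rm
    rcases occ_bit μ (lev ℓ i N s) with h | h <;> rcases occ_bit μ (lev ℓ i N s + 1) with h' | h' <;>
      simp [h, h']
  · rintro b ⟨⟨h1, _⟩, _⟩ b' ⟨⟨h2, _⟩, _⟩ h
    obtain ⟨ν, hν⟩ := isAddable_iff.1 h1
    obtain ⟨ν', hν'⟩ := isAddable_iff.1 h2
    exact cov_box_eq hν hν' h (Or.inl rfl)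
  · intro c
    constructor
    · rintro ⟨b', ⟨⟨h1, h2⟩, h3⟩, rfl⟩
      obtain ⟨ν, hν⟩ := isAddable_iff.1 h1
      refine ⟨ad_iff.2 ⟨_, _, hν, rfl⟩, h2, ?_⟩
      rw [← hb]; exact h3
    · rintro ⟨h1, h2, h3⟩
      obtain ⟨ν, b', h, rfl⟩ := ad_iff.1 h1
      refine ⟨b', ⟨⟨isAddable_iff.2 ⟨_, h⟩, h2⟩, ?_⟩, rfl⟩
      rw [← hb] at h3; exact h3
  · intro c hc
    have := ad_bound (n := μ.card) le_rfl hc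
    omega
  · rintro b ⟨⟨h1, _⟩, _⟩ b' ⟨⟨h2, _⟩, _⟩ h
    obtain ⟨ν, hν⟩ := isRemovable_iff.1 h1
    obtain ⟨ν', hν'⟩ := isRemovable_iff.1 h2
    exact cov_box_eq hν hν' h (Or.inr rfl)
  · intro c
    constructor
    · rintro ⟨b', ⟨⟨h1, h2⟩, h3⟩, rfl⟩
      obtain ⟨ν, hν⟩ := isRemovable_iff.1 h1
      refine ⟨rm_iff.2 ⟨_, _, hν, rfl⟩, h2, ?_⟩
      rw [← hb]; exact h3
    · rintro ⟨h1, h2, h3⟩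
      obtain ⟨ν, b', h, rfl⟩ := rm_iff.1 h1
      refine ⟨b', ⟨⟨isRemovable_iff.2 ⟨_, h⟩, h2⟩, ?_⟩, rfl⟩
      rw [← hb] at h3; exact h3
  · intro c hc
    have := rm_bound (n := μ.card) le_rfl hc
    omega

theorem R_finite (ℓ : ℕ) (i : ZMod ℓ) (μ : YoungDiagram) : (R ℓ i μ).Finite := by
  apply Set.Finite.subset μ.cells.finite_toSet
  rintro b ⟨⟨h1, _⟩, _⟩
  exact h1

theorem Evec_apply {ℓ : ℕ} (hℓ : 2 ≤ ℓ) (i : ZMod ℓ) {N : ℕ} (lam μ : YoungDiagram) (hN : μ.card < N) :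
    Evec ℓ i lam μ = ∑ t ∈ Finset.range (2 * N), if Ad μ (lev ℓ i N t) then
      v ^ (hgt ℓ i N μ t) * (Finsupp.single lam (1 : RatFunc ℚ)) (up μ (lev ℓ i N t)) else 0 := by
  unfold Evec
  rw [finsum_mem_eq_finite_toFinset_sum _ (R_finite ℓ i lam), Finsupp.finset_sum_apply]
  by_cases hex : ∃ b, Cov μ lam b ∧ color ℓ b = i
  · obtain ⟨b, hb, hc⟩ := hex
    have had : Ad μ (content b) := ad_iff.2 ⟨_, _, hb, rfl⟩
    have hbd := ad_bound (n := μ.card) le_rfl had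
    obtain ⟨t, ht, htc⟩ := exists_lev (N := N) (c := content b) hℓ hc (by omega) (by omega)
    rw [Finset.sum_eq_single b, Finset.sum_eq_single t]
    · rw [htc, if_pos had, up_eq hb, erased_eq hb, Nr_eq hℓ hN htc.symm]
      simp
    · intro s _ hst
      split_ifs with h
      · obtain ⟨ν, b', h1, h2⟩ := ad_iff.1 h
        rw [← h2, up_eq h1, Finsupp.single_apply, if_neg, mul_zero]
        intro h3
        subst h3
        have := cov_unique_box hb h1
        subst this
        exact hst (lev_inj hℓ (h2.symm.trans htc.symm))
      · rfl
    · intro h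
      exact absurd (Finset.mem_range.2 ht) h
    · intro b' hb' hne
      rw [Set.Finite.mem_toFinset] at hb'
      obtain ⟨κ, hκ⟩ := isRemovable_iff.1 hb'.1
      rw [erased_eq hκ, Finsupp.smul_apply, Finsupp.single_apply, if_neg, smul_zero]
      intro h
      subst h
      exact hne (cov_unique_box hκ hb)
    · intro h
      rw [Set.Finite.mem_toFinset] at h
      exact absurd ⟨isRemovable_iff.2 ⟨_, hb⟩, hc⟩ h
  · rw [Finset.sum_eq_zero, Finset.sum_eq_zero]
    · intro s _
      split_ifs with h
      · obtain ⟨ν, b', h1, h2⟩ := ad_iff.1 h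
        rw [← h2, up_eq h1, Finsupp.single_apply, if_neg, mul_zero]
        intro h3
        subst h3
        exact hex ⟨b', h1, by unfold color; rw [h2, lev_color hℓ]⟩
      · rfl
    · intro b' hb'
      rw [Set.Finite.mem_toFinset] at hb'
      obtain ⟨κ, hκ⟩ := isRemovable_iff.1 hb'.1
      rw [erased_eq hκ, Finsupp.smul_apply, Finsupp.single_apply, if_neg, smul_zero]
      intro h
      subst h
      exact hex ⟨b', hκ, hb'.2⟩

theorem Eop_apply {ℓ : ℕ} (hℓ : 2 ≤ ℓ) (i : ZMod ℓ) {N : ℕ} (u : Fock) (μ : YoungDiagram)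
    (hN : μ.card < N) :
    Eop ℓ i u μ = ∑ t ∈ Finset.range (2 * N), if Ad μ (lev ℓ i N t) then
      v ^ (hgt ℓ i N μ t) * u (up μ (lev ℓ i N t)) else 0 := by
  induction u using Finsupp.induction_linear with
  | zero => simp
  | add f g hf hg =>
    rw [map_add, Finsupp.add_apply, hf, hg, ← Finset.sum_add_distrib]
    apply Finset.sum_congr rfl
    intro t _
    split_ifs
    · rw [Finsupp.add_apply, mul_add]
    · simp
  | single lam a =>
    have : Eop ℓ i (Finsupp.single lam a) = a • Evec ℓ i lam := by
      unfold Eop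
      simp
    rw [this, Finsupp.smul_apply, Evec_apply hℓ i lam μ hN, smul_eq_mul, Finset.mul_sum]
    apply Finset.sum_congr rfl
    intro t _
    split_ifs
    · rw [Finsupp.single_apply, Finsupp.single_apply]
      split_ifs <;> ring
    · simp

theorem mem_degComp {n : ℕ} {u : Fock} : u ∈ degComp n ↔ ∀ lam : YoungDiagram, lam.card ≠ n → u lam = 0 := by
  have : degComp n = Finsupp.supported (RatFunc ℚ) (RatFunc ℚ) {lam : YoungDiagram | lam.card = n} := by
    rw [Finsupp.supported_eq_span_single]
    unfold degComp
    congr 1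
    ext f
    simp only [Set.mem_image, Set.mem_ofPred_eq]
    constructor
    · rintro ⟨lam, h, rfl⟩; exact ⟨lam, h, rfl⟩
    · rintro ⟨lam, h, rfl⟩; exact ⟨lam, h, rfl⟩
  rw [this, Finsupp.mem_supported']
  rfl

/-! ### Part 3: crystal argument -/

/-- the `v`-adic valuation -/
noncomputable def vw : Valuation (RatFunc ℚ) (WithZero (Multiplicative ℤ)) :=
  (Polynomial.idealX ℚ).valuation (RatFunc ℚ)

theorem v_ne : v ≠ 0 := RatFunc.X_ne_zero

theorem vw_v : vw v < 1 := by
  unfold vw v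
  rw [Polynomial.valuation_X_eq_neg_one]
  decide

theorem vw_zpow {a b : ℤ} (h : a < b) : vw (v ^ b) < vw (v ^ a) := by
  have h0 : vw v ≠ 0 := by
    rw [Valuation.ne_zero_iff]; exact v_ne
  rw [map_zpow₀, map_zpow₀]
  exact zpow_lt_zpow_right_of_lt_one₀ (zero_lt_iff.2 h0) vw_v h

theorem hgt_succ (ℓ : ℕ) (i : ZMod ℓ) (N : ℕ) (μ : YoungDiagram) (t : ℕ) :
    hgt ℓ i N μ (t + 1) = hgt ℓ i N μ t + (occ μ (lev ℓ i N t) - occ μ (lev ℓ i N t + 1)) := by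
  unfold hgt
  rw [Finset.sum_range_succ]

theorem lev_ne_succ {ℓ : ℕ} (hℓ : 2 ≤ ℓ) (i : ZMod ℓ) (N s t : ℕ) :
    lev ℓ i N s ≠ lev ℓ i N t + 1 := by
  intro h
  have h1 := congrArg (fun z : ℤ => (z : ZMod ℓ)) h
  simp only [Int.cast_add, Int.cast_one, lev_color hℓ] at h1
  have h2 : (1 : ZMod ℓ) = 0 := by simpa using h1
  have : Fact (1 < ℓ) := ⟨by omega⟩
  exact one_ne_zero h2

theorem hgt_cov {ℓ : ℕ} (hℓ : 2 ≤ ℓ) {i : ZMod ℓ} {N : ℕ} {μ ν : YoungDiagram} {b : ℕ × ℕ} {t : ℕ}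
    (h : Cov μ ν b) (hb : content b = lev ℓ i N t) (s : ℕ) :
    hgt ℓ i N ν s = hgt ℓ i N μ s - if t < s then 2 else 0 := by
  induction s with
  | zero => simp [hgt]
  | succ s ih =>
    rw [hgt_succ, hgt_succ, ih, cov_occ h, cov_occ h, hb]
    have e1 : lev ℓ i N s ≠ lev ℓ i N t + 1 := lev_ne_succ hℓ i N s t
    have e2 : lev ℓ i N s + 1 ≠ lev ℓ i N t := fun hh => lev_ne_succ hℓ i N t s hh.symm
    rw [if_neg e1, if_neg e2]
    by_cases hst : s = t
    · subst hst
      simp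
      ring
    · have e3 : lev ℓ i N s ≠ lev ℓ i N t := fun hh => hst (lev_inj hℓ hh)
      have e4 : lev ℓ i N s + 1 ≠ lev ℓ i N t + 1 := fun hh => e3 (by linarith)
      rw [if_neg e3, if_neg e4]
      by_cases hlt : t < s
      · rw [if_pos hlt, if_pos (by omega)]; ring
      · rw [if_neg hlt, if_neg (by omega)]; ring

theorem crystal_aux {ℓ : ℕ} (hℓ : 2 ≤ ℓ) {i : ZMod ℓ} {n N : ℕ} (hN : n < N) {u : Fock}
    (hE : Eop ℓ i u = 0) (hbnd : ∀ lam, vw (u lam) ≤ 1) (p : ℕ) :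
    ∀ lam : YoungDiagram, lam.card = n → p ≤ 2 * N → hgt ℓ i N lam p < 0 →
      (∀ s, s ≤ 2 * N → hgt ℓ i N lam p ≤ hgt ℓ i N lam s) → vw (u lam) < 1 := by
  induction p using Nat.strong_induction_on with
  | _ p ih =>
  intro lam hcard hp hneg hmin
  by_cases hfirst : ∃ s < p, hgt ℓ i N lam s = hgt ℓ i N lam p
  · obtain ⟨s, hs, he⟩ := hfirst
    exact ih s hs lam hcard (by omega) (by rw [he]; exact hneg) (by rw [he]; exact hmin)
  push Not at hfirst
  obtain _ | t0 := p
  · simp [hgt] at hneg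
  set m := hgt ℓ i N lam (t0 + 1) with hm
  have hlt : ∀ s, s ≤ t0 → m + 1 ≤ hgt ℓ i N lam s := by
    intro s hs
    have h1 := hfirst s (by omega)
    have h2 := hmin s (by omega)
    omega
  have hst := hgt_succ ℓ i N lam t0
  rw [← hm] at hst
  have h3 := hlt t0 le_rfl
  have hRm : Rm lam (lev ℓ i N t0) ∧ hgt ℓ i N lam t0 = m + 1 := by
    unfold Rm
    rcases occ_bit lam (lev ℓ i N t0) with h | h <;>
    rcases occ_bit lam (lev ℓ i N t0 + 1) with h' | h' <;> rw [h, h'] at hst ⊢ <;> omega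
  obtain ⟨hRm, ht0⟩ := hRm
  obtain ⟨μ, b, hcov, hb⟩ := rm_iff.1 hRm
  have hcc := cov_card hcov
  have hEμ := Eop_apply hℓ i u μ (N := N) (by omega)
  rw [hE] at hEμ
  have ht0r : t0 ∈ Finset.range (2 * N) := Finset.mem_range.2 (by omega)
  rw [← Finset.add_sum_erase _ _ ht0r, if_pos (ad_iff.2 ⟨_, _, hcov, hb⟩), ← hb, up_eq hcov] at hEμ
  have hh := hgt_cov hℓ hcov hb
  have hμ0 : hgt ℓ i N μ t0 = m + 1 := by
    have := hh t0
    rw [if_neg (lt_irrefl _)] at this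
    omega
  rw [hμ0] at hEμ
  have hvm : vw (v ^ (m + 1)) ≠ 0 := by
    rw [Valuation.ne_zero_iff]; exact zpow_ne_zero _ v_ne
  have hbig : ∀ k : ℤ, m + 2 ≤ k → ∀ x, vw x ≤ 1 → vw (v ^ k * x) < vw (v ^ (m + 1)) := by
    intro k hk x hx
    rw [map_mul]
    calc vw (v ^ k) * vw x ≤ vw (v ^ k) * 1 := by gcongr
      _ = vw (v ^ k) := mul_one _
      _ < _ := vw_zpow (by omega)
  have hsum : vw (∑ t ∈ (Finset.range (2 * N)).erase t0, if Ad μ (lev ℓ i N t) then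
      v ^ (hgt ℓ i N μ t) * u (up μ (lev ℓ i N t)) else 0) < vw (v ^ (m + 1)) := by
    apply Valuation.map_sum_lt _ hvm
    intro t ht
    rw [Finset.mem_erase, Finset.mem_range] at ht
    split_ifs with had
    · rcases lt_or_gt_of_ne ht.1 with h1 | h1
      · have e1 := hh t
        rw [if_neg (by omega)] at e1
        have e2 := hlt t (by omega)
        rcases eq_or_lt_of_le e2 with e3 | e3
        · obtain ⟨lam', b', hcov', hb'⟩ := ad_iff.1 had
          rw [← hb', up_eq hcov']
          have hh' := hgt_cov hℓ hcov' hb'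
          have hcard' := cov_card hcov'
          have hlt1 : vw (u lam') < 1 := by
            have k1 : hgt ℓ i N lam' (t + 1) = m := by
              have := hh' (t + 1)
              rw [if_pos (by omega), hgt_succ _ _ _ μ, had.1, had.2] at this
              omega
            have k2 : ∀ s, t0 + 1 ≤ s → hgt ℓ i N lam' s = hgt ℓ i N lam s := by
              intro s hs
              rw [hh', hh, if_pos (by omega), if_pos (by omega)]
            obtain ⟨q, hq, hqmin⟩ := Finset.exists_min_image (Finset.range (2 * N + 1))
              (fun s => hgt ℓ i N lam' s) ⟨0, by simp⟩
            rw [Finset.mem_range] at hq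
            have hqmin' : ∀ s, s ≤ 2 * N → hgt ℓ i N lam' q ≤ hgt ℓ i N lam' s :=
              fun s hs => hqmin s (Finset.mem_range.2 (by omega))
            by_cases hqp : q < t0 + 1
            · apply ih q hqp lam' (by omega) (by omega) _ hqmin'
              have := hqmin' (t + 1) (by omega)
              omega
            · apply ih (t + 1) (by omega) lam' (by omega) (by omega) (by omega)
              intro s hs
              have k3 := k2 q (by omega)
              have k4 := hmin q (by omega)
              have k5 := hqmin' s hs
              omega
          have : hgt ℓ i N μ t = m + 1 := by omega
          rw [this, map_mul]
          calc _ < vw (v ^ (m + 1)) * 1 := by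
                apply mul_lt_mul_of_pos_left hlt1 (zero_lt_iff.2 hvm)
            _ = _ := mul_one _
        · apply hbig _ (by omega) _ (hbnd _)
      · have e1 := hh t
        rw [if_pos (by omega)] at e1
        have e2 := hmin t (by omega)
        apply hbig _ (by omega) _ (hbnd _)
    · rw [map_zero]; exact zero_lt_iff.2 hvm
  have heq : v ^ (m + 1) * u lam = - (∑ t ∈ (Finset.range (2 * N)).erase t0,
      if Ad μ (lev ℓ i N t) then v ^ (hgt ℓ i N μ t) * u (up μ (lev ℓ i N t)) else 0) := by
    rw [eq_neg_iff_add_eq_zero, ← hEμ]; rfl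
  rw [← Valuation.map_neg, ← heq, map_mul] at hsum
  by_contra hge
  push Not at hge
  have : vw (v ^ (m + 1)) * 1 ≤ vw (v ^ (m + 1)) * vw (u lam) := by gcongr
  rw [mul_one] at this
  exact absurd hsum (not_lt.2 this)

theorem crystal {ℓ : ℕ} (hℓ : 2 ≤ ℓ) {i : ZMod ℓ} {n N : ℕ} (hN : n < N) {u : Fock}
    (hE : Eop ℓ i u = 0) (hbnd : ∀ lam, vw (u lam) ≤ 1) {lam : YoungDiagram} (hc : lam.card = n)
    {s : ℕ} (hs : s ≤ 2 * N) (hneg : hgt ℓ i N lam s < 0) : vw (u lam) < 1 := by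
  obtain ⟨q, hq, hqmin⟩ := Finset.exists_min_image (Finset.range (2 * N + 1))
    (fun s => hgt ℓ i N lam s) ⟨0, by simp⟩
  rw [Finset.mem_range] at hq
  have hqmin' : ∀ s, s ≤ 2 * N → hgt ℓ i N lam q ≤ hgt ℓ i N lam s :=
    fun s hs => hqmin s (Finset.mem_range.2 (by omega))
  have := hqmin' s hs
  exact crystal_aux hℓ hN hE hbnd q lam hc (by omega) (by omega) hqmin'

theorem exists_lev' {ℓ : ℕ} (hℓ : 2 ≤ ℓ) {i : ZMod ℓ} {N s : ℕ} {c : ℤ} (hc : (c : ZMod ℓ) = i)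
    (h1 : lev ℓ i N s ≤ c) : ∃ t, lev ℓ i N t = c := by
  have hd : (ℓ : ℤ) ∣ c - lev ℓ i N s := by
    rw [← ZMod.intCast_zmod_eq_zero_iff_dvd]
    push_cast
    rw [lev_color hℓ, hc, sub_self]
  obtain ⟨k, hk⟩ := hd
  have hk0 : 0 ≤ k := by
    by_contra hh
    have : (ℓ : ℤ) * k < 0 := mul_neg_of_pos_of_neg (by omega) (by omega)
    omega
  refine ⟨s + k.toNat, ?_⟩
  unfold lev at hk ⊢
  push_cast
  rw [Int.toNat_of_nonneg hk0]
  linarith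

theorem dvd_of_hgt {ℓ : ℕ} (hℓ : 2 ≤ ℓ) {N : ℕ} {lam : YoungDiagram} (hN : lam.card < N)
    (h : ∀ (i : ZMod ℓ) (s : ℕ), s ≤ 2 * N → 0 ≤ hgt ℓ i N lam s) (j : ℕ) : ℓ ∣ lam.rowLen j := by
  by_contra hj0
  obtain ⟨M, hM⟩ := eventually_rowLen_zero lam
  have hfin : ∀ k, M ≤ k → ℓ ∣ lam.rowLen k := by
    intro k hk
    have := lam.rowLen_anti M k hk
    have : lam.rowLen k = 0 := by omega
    rw [this]; exact dvd_zero _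
  have hne : ((Finset.range M).filter (fun k => ¬ ℓ ∣ lam.rowLen k)).Nonempty := by
    refine ⟨j, ?_⟩
    rw [Finset.mem_filter, Finset.mem_range]
    refine ⟨?_, hj0⟩
    by_contra hh
    exact hj0 (hfin j (by omega))
  obtain ⟨j, hj, hjmax⟩ := Finset.exists_max_image _ (fun k => k) hne
  rw [Finset.mem_filter, Finset.mem_range] at hj
  have hdiv : ∀ k, j < k → ℓ ∣ lam.rowLen k := by
    intro k hk
    by_contra hh
    by_cases hkM : M ≤ k
    · exact hh (hfin k hkM)
    · have := hjmax k (by rw [Finset.mem_filter, Finset.mem_range]; exact ⟨by omega, hh⟩)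
      omega
  have hpos : lam.rowLen j ≠ 0 := by
    intro hh
    apply hj.2
    rw [hh]; exact dvd_zero _
  have hle := @rowLen_le_card lam j
  obtain ⟨i, hi⟩ : ∃ i : ZMod ℓ, i = ((beta lam j - 1 : ℤ) : ZMod ℓ) := ⟨_, rfl⟩
  obtain ⟨t, ht, htc⟩ := exists_lev (N := N) (c := beta lam j - 1) hℓ hi.symm
    (by unfold beta; omega) (by unfold beta; omega)
  have hh := h i (t + 1) (by omega)
  have hsum : hgt ℓ i N lam (t + 1) =
      (((Finset.range (t + 1)).filter (fun s => occ lam (lev ℓ i N s) = 1)).card : ℤ) -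
      (((Finset.range (t + 1)).filter (fun s => occ lam (lev ℓ i N s + 1) = 1)).card : ℤ) := by
    unfold hgt
    rw [Finset.card_filter, Finset.card_filter]
    push_cast
    rw [← Finset.sum_sub_distrib]
    apply Finset.sum_congr rfl
    intro s _
    rcases occ_bit lam (lev ℓ i N s) with h | h <;>
      rcases occ_bit lam (lev ℓ i N s + 1) with h' | h' <;> simp [h, h']
  have htB : t ∈ (Finset.range (t + 1)).filter (fun s => occ lam (lev ℓ i N s + 1) = 1) := by
    rw [Finset.mem_filter, Finset.mem_range]
    refine ⟨by omega, occ_one.2 ⟨j, ?_⟩⟩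
    omega
  have hcol : ∀ s, ((lev ℓ i N s : ℤ) : ZMod ℓ) = i := fun s => lev_color hℓ i N s
  have hzero : ∀ k, j < k → ((lam.rowLen k : ℕ) : ZMod ℓ) = 0 := by
    intro k hk
    rw [ZMod.natCast_eq_zero_iff]; exact hdiv k hk
  have hmap : ∀ s ∈ (Finset.range (t + 1)).filter (fun s => occ lam (lev ℓ i N s) = 1),
      ∃ s' ∈ ((Finset.range (t + 1)).filter (fun s => occ lam (lev ℓ i N s + 1) = 1)).erase t,
      ∃ k, beta lam (k + 1) = lev ℓ i N s ∧ beta lam k = lev ℓ i N s' + 1 := by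
    intro s hs
    rw [Finset.mem_filter, Finset.mem_range] at hs
    obtain ⟨k', hk'⟩ := occ_one.1 hs.2
    have hlev : lev ℓ i N s ≤ lev ℓ i N t := by
      by_contra hc
      have := (lev_lt hℓ).1 (not_le.1 hc)
      omega
    have hjk : j < k' := by
      by_contra hc
      rcases eq_or_lt_of_le (not_lt.1 hc) with e | e
      · subst e; omega
      · have := beta_lt lam e; omega
    obtain _ | k := k'
    · omega
    have hi' : i = -((k : ZMod ℓ) + 1) := by
      rw [← hcol s, ← hk']
      unfold beta
      push_cast
      rw [hzero _ hjk]; ring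
    have hkj : k ≠ j := by
      intro e
      subst e
      apply hj.2
      rw [← ZMod.natCast_eq_zero_iff]
      have e1 := hi.symm.trans hi'
      unfold beta at e1
      push_cast at e1
      linear_combination e1
    have hkj' : j < k := by omega
    have hb1 := beta_lt lam hkj'
    have hb2 := beta_lt lam (show k < k + 1 by omega)
    obtain ⟨s', hc'⟩ := exists_lev' (i := i) (N := N) (s := s) (c := beta lam k - 1) hℓ (by
      rw [hi']; unfold beta; push_cast; rw [hzero _ hkj']; ring) (by omega)
    refine ⟨s', ?_, k, hk', by omega⟩
    have hlt : s' < t := by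
      rw [← lev_lt hℓ (i := i) (N := N)]; omega
    rw [Finset.mem_erase, Finset.mem_filter, Finset.mem_range]
    exact ⟨by omega, by omega, occ_one.2 ⟨k, by omega⟩⟩
  choose! f hf hf' using hmap
  have hcle := Finset.card_le_card_of_injOn f hf (by
    intro s1 h1 s2 h2 he
    obtain ⟨k1, e1, e2⟩ := hf' s1 h1
    obtain ⟨k2, e3, e4⟩ := hf' s2 h2
    rw [he] at e2
    have := beta_inj lam (e2.trans e4.symm)
    subst this
    exact lev_inj hℓ (e1.symm.trans e3))
  rw [Finset.card_erase_of_mem htB] at hcle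
  have := Finset.card_pos.2 ⟨t, htB⟩
  omega

theorem hw_zero {ℓ : ℕ} (hℓ : 2 ≤ ℓ) {n : ℕ} {u : Fock} (hu : u ∈ degComp n)
    (hE : ∀ i, Eop ℓ i u = 0)
    (h : ∀ lam : YoungDiagram, lam.card = n → (∀ j, ℓ ∣ lam.rowLen j) → u lam = 0) : u = 0 := by
  by_contra hne
  have hsupp : u.support.Nonempty := Finsupp.support_nonempty_iff.2 hne
  obtain ⟨l0, hl0, hmax⟩ := Finset.exists_max_image u.support (fun l => vw (u l)) hsupp
  have hu0 : u l0 ≠ 0 := Finsupp.mem_support_iff.1 hl0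
  have hw0 : vw (u l0) ≠ 0 := by rw [Valuation.ne_zero_iff]; exact hu0
  have hcard : l0.card = n := by
    by_contra hc
    exact hu0 (mem_degComp.1 hu l0 hc)
  apply hu0
  apply h l0 hcard
  apply dvd_of_hgt hℓ (N := n + 1) (by omega)
  intro i s hs
  by_contra hneg
  have := crystal hℓ (i := i) (n := n) (N := n + 1) (u := (u l0)⁻¹ • u) (by omega)
    (by rw [map_smul, hE, smul_zero]) (by
      intro lam
      rw [Finsupp.smul_apply, smul_eq_mul, map_mul, map_inv₀]
      by_cases hz : u lam = 0
      · rw [hz, map_zero, mul_zero]; exact zero_le_one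
      · have := hmax lam (Finsupp.mem_support_iff.2 hz)
        rw [inv_mul_le_iff₀ (zero_lt_iff.2 hw0), mul_one]
        exact this) hcard hs (not_le.1 hneg)
  rw [Finsupp.smul_apply, smul_eq_mul, inv_mul_cancel₀ hu0, map_one] at this
  exact lt_irrefl _ this

/-! ### Part 4: the partitions all of whose rows are divisible by `ℓ` -/

theorem exists_T (ℓ : ℕ) (l : List ℕ) :
    ∃ lam : YoungDiagram, ∀ j, lam.rowLen j = ℓ * l.countP (fun x => decide (j < x)) := by
  refine exists_of_rowLen (fun j => ℓ * l.countP (fun x => decide (j < x))) ?_ l.sum ?_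
  · intro a b hab
    apply Nat.mul_le_mul_left
    apply List.countP_mono_left
    intro x _ hx
    simp only [decide_eq_true_eq] at hx ⊢
    omega
  · simp only [mul_eq_zero]
    right
    rw [List.countP_eq_zero]
    intro x hx
    have := List.le_sum_of_mem hx
    simpa using this

/-- The partition with row lengths `ℓ * #{parts > j}`. -/
noncomputable def T (ℓ : ℕ) (l : List ℕ) : YoungDiagram := (exists_T ℓ l).choose

theorem T_rowLen (ℓ : ℕ) (l : List ℕ) (j : ℕ) :
    (T ℓ l).rowLen j = ℓ * l.countP (fun x => decide (j < x)) := (exists_T ℓ l).choose_spec j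

theorem sum_countP (l : List ℕ) (N : ℕ) (h : ∀ x ∈ l, x ≤ N) :
    ∑ j ∈ Finset.range N, l.countP (fun x => decide (j < x)) = l.sum := by
  induction l with
  | nil => simp
  | cons a l ih =>
    simp only [List.countP_cons, List.sum_cons]
    rw [Finset.sum_add_distrib, ih (fun x hx => h x (List.mem_cons_of_mem _ hx)), add_comm]
    congr 1
    have ha := h a List.mem_cons_self
    simp only [decide_eq_true_eq]
    rw [← Finset.card_filter]
    have : (Finset.range N).filter (fun j => j < a) = Finset.range a := by
      ext j; simp; omega
    rw [this, Finset.card_range]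

theorem T_card (ℓ : ℕ) (l : List ℕ) : (T ℓ l).card = ℓ * l.sum := by
  have h : (T ℓ l).rowLen l.sum = 0 := by
    rw [T_rowLen, List.countP_eq_zero.2, mul_zero]
    intro x hx
    have := List.le_sum_of_mem hx
    simpa using this
  rw [card_eq_sum h, Finset.sum_congr rfl (fun j _ => T_rowLen ℓ l j), ← Finset.mul_sum,
    sum_countP]
  intro x hx
  exact List.le_sum_of_mem hx

theorem T_perm {ℓ : ℕ} {l l' : List ℕ} (h : l.Perm l') : T ℓ l = T ℓ l' := by
  apply yd_ext
  intro j
  rw [T_rowLen, T_rowLen, h.countP_eq]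

/-- sorted list of parts -/
def plist {m : ℕ} (p : Nat.Partition m) : List ℕ := p.parts.sort (· ≥ ·)

theorem plist_coe {m : ℕ} (p : Nat.Partition m) : ((plist p : List ℕ) : Multiset ℕ) = p.parts := by
  unfold plist; simp

theorem plist_sum {m : ℕ} (p : Nat.Partition m) : (plist p).sum = m := by
  rw [← Multiset.sum_coe, plist_coe, p.parts_sum]

theorem exists_partition {ℓ : ℕ} (hℓ : 2 ≤ ℓ) {lam : YoungDiagram} (h : ∀ j, ℓ ∣ lam.rowLen j) :
    ∃ m, lam.card = ℓ * m ∧ ∃ p : Nat.Partition m, lam = T ℓ (plist p) := by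
  set r : ℕ → ℕ := fun j => lam.rowLen j / ℓ with hr
  have hr' : ∀ j, lam.rowLen j = ℓ * r j := fun j => (Nat.mul_div_cancel' (h j)).symm
  set l : List ℕ := (List.range (r 0)).map (fun c => lam.colLen (ℓ * c)) with hl
  have hcol : ∀ j c, j < lam.colLen (ℓ * c) ↔ c < r j := by
    intro j c
    rw [← YoungDiagram.mem_iff_lt_colLen, YoungDiagram.mem_iff_lt_rowLen, hr']
    exact Nat.mul_lt_mul_left (by omega)
  have hcount : ∀ j, l.countP (fun x => decide (j < x)) = r j := by
    intro j
    rw [hl, List.countP_map]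
    have h1 : ((fun x => decide (j < x)) ∘ fun c => lam.colLen (ℓ * c)) = fun c => decide (c < r j) := by
      funext c
      simp only [Function.comp, hcol]
    rw [h1]
    have hle : r j ≤ r 0 := Nat.div_le_div_right (lam.rowLen_anti 0 j (Nat.zero_le _))
    have : r 0 = r j + (r 0 - r j) := by omega
    rw [this, List.range_add, List.countP_append, List.countP_map]
    rw [List.countP_eq_length.2 (by simp), List.countP_eq_zero.2 (by simp)]
    simp
  have hlam : lam = T ℓ l := by
    apply yd_ext
    intro j
    rw [T_rowLen, hcount, hr']
  refine ⟨l.sum, (congrArg YoungDiagram.card hlam).trans (T_card ℓ l),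
    ⟨(l : Multiset ℕ), ?_, Multiset.sum_coe l⟩, ?_⟩
  · intro x hx
    simp only [hl, Multiset.mem_coe, List.mem_map, List.mem_range] at hx
    obtain ⟨c, hc, rfl⟩ := hx
    exact (hcol 0 c).2 hc
  · refine hlam.trans (T_perm (Multiset.coe_eq_coe.1 ?_))
    rw [plist_coe]

/-- The space of highest weight vectors of degree `n`. -/
noncomputable def HW (ℓ n : ℕ) : Submodule (RatFunc ℚ) Fock :=
  degComp n ⊓ ⨅ i : ZMod ℓ, LinearMap.ker (Eop ℓ i)

theorem mem_HW {ℓ n : ℕ} {u : Fock} : u ∈ HW ℓ n ↔ u ∈ degComp n ∧ ∀ i, Eop ℓ i u = 0 := by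
  unfold HW
  rw [Submodule.mem_inf, Submodule.mem_iInf]
  simp only [LinearMap.mem_ker]

theorem HW_bot {ℓ n : ℕ} (hℓ : 2 ≤ ℓ) (h : ¬ ℓ ∣ n) : HW ℓ n = ⊥ := by
  rw [eq_bot_iff]
  intro u hu
  rw [mem_HW] at hu
  rw [Submodule.mem_bot]
  apply hw_zero hℓ hu.1 hu.2
  intro lam hc hd
  obtain ⟨m, hm, _⟩ := exists_partition hℓ hd
  exact absurd ⟨m, hc.symm.trans hm⟩ h

/-- evaluation at the partitions `T p` -/
noncomputable def evT (ℓ m : ℕ) : HW ℓ (ℓ * m) →ₗ[RatFunc ℚ] (Nat.Partition m → RatFunc ℚ) where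
  toFun u p := (u : Fock) (T ℓ (plist p))
  map_add' u w := by funext p; simp
  map_smul' a u := by funext p; simp

theorem evT_inj {ℓ : ℕ} (hℓ : 2 ≤ ℓ) (m : ℕ) : Function.Injective (evT ℓ m) := by
  rw [injective_iff_map_eq_zero]
  rintro ⟨u, hu⟩ h
  rw [mem_HW] at hu
  apply Subtype.ext
  apply hw_zero hℓ hu.1 hu.2
  intro lam hc hd
  obtain ⟨m', hm, p, hp⟩ := exists_partition hℓ hd
  have : m' = m := by
    rw [hc] at hm
    exact (Nat.eq_of_mul_eq_mul_left (by omega) hm).symm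
  subst this
  rw [hp]
  exact congrFun h p

theorem HW_finite {ℓ : ℕ} (hℓ : 2 ≤ ℓ) (m : ℕ) : Module.Finite (RatFunc ℚ) (HW ℓ (ℓ * m)) :=
  Module.Finite.of_injective (evT ℓ m) (evT_inj hℓ m)

theorem HW_le {ℓ : ℕ} (hℓ : 2 ≤ ℓ) (m : ℕ) :
    Module.finrank (RatFunc ℚ) (HW ℓ (ℓ * m)) ≤ Fintype.card (Nat.Partition m) := by
  have := LinearMap.finrank_le_finrank_of_injective (evT_inj hℓ m)
  rwa [Module.finrank_fintype_fun_eq_card] at this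

/-! ### Part 5: the local identity and telescoping -/

/-- local weight of one level of the transfer operator -/
noncomputable def om (a b x y X Y : ℤ) : RatFunc ℚ :=
  if (0 ≤ x ∧ x ≤ 1) ∧ (0 ≤ y ∧ y ≤ 1) ∧ (0 ≤ X ∧ X ≤ a) ∧ (0 ≤ Y ∧ Y ≤ b) then
    (-v) ^ ((a - X) * y + (b - Y) * X) else 0

theorem om_local {a b x y X Y A B : ℤ} (ha : a = 0 ∨ a = 1) (hb : b = 0 ∨ b = 1)
    (hA : A = a + x - X) (hB : B = b + y - Y) (hA' : A = 0 ∨ A = 1) (hB' : B = 0 ∨ B = 1)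
    (hx : x = 0 ∨ x = 1) (hy : y = 0 ∨ y = 1) (hX : X = -1 ∨ X = 0) (hY : Y = 1 ∨ Y = 2) :
    (if A = 1 ∧ B = 0 then om a b x y (X + 1) (Y - 1) else 0) + v ^ (A - B) * om a b x y X Y =
    v ^ (x - y) * (if a = 0 ∧ b = 1 then om 1 0 x y (X + 1) (Y - 1) else 0) +
      om a b (x + 1) (y - 1) (X + 1) (Y - 1) := by
  have hv := v_ne
  rcases ha with rfl | rfl <;> rcases hb with rfl | rfl <;> rcases hx with rfl | rfl <;>
  rcases hy with rfl | rfl <;> rcases hX with rfl | rfl <;> rcases hY with rfl | rfl <;>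
  subst hA hB <;>
  first
  | (exfalso; omega)
  | (unfold om; norm_num; done)
  | (unfold om; norm_num; field_simp; done)
  | (unfold om; norm_num; field_simp; ring)

theorem telescope (K : ℕ) (a b x y A B : ℕ → ℤ)
    (ha : ∀ s, a s = 0 ∨ a s = 1) (hb : ∀ s, b s = 0 ∨ b s = 1)
    (hA : ∀ s, A s = a s + x s - x (s + 1)) (hB : ∀ s, B s = b s + y s - y (s + 1))
    (hA' : ∀ s, A s = 0 ∨ A s = 1) (hB' : ∀ s, B s = 0 ∨ B s = 1)
    (hx0 : x 0 = 0) (hy0 : y 0 = 0) (hxK : x K = -1) (hyK : y K = 1) :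
    ∑ t ∈ Finset.range K, (if A t = 1 ∧ B t = 0 then v ^ (∑ s ∈ Finset.range t, (A s - B s)) *
      ((∏ s ∈ Finset.range t, om (a s) (b s) (x s) (y s) (x (s + 1)) (y (s + 1))) *
      om (a t) (b t) (x t) (y t) (x (t + 1) + 1) (y (t + 1) - 1) *
      ∏ s ∈ Finset.Ico (t + 1) K,
        om (a s) (b s) (x s + 1) (y s - 1) (x (s + 1) + 1) (y (s + 1) - 1)) else 0) =
    ∑ t ∈ Finset.range K, (if a t = 0 ∧ b t = 1 then v ^ (∑ s ∈ Finset.range t, (a s - b s)) *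
      ((∏ s ∈ Finset.range t, om (a s) (b s) (x s) (y s) (x (s + 1)) (y (s + 1))) *
      om 1 0 (x t) (y t) (x (t + 1) + 1) (y (t + 1) - 1) *
      ∏ s ∈ Finset.Ico (t + 1) K,
        om (a s) (b s) (x s + 1) (y s - 1) (x (s + 1) + 1) (y (s + 1) - 1)) else 0) := by
  obtain ⟨P, hP⟩ : ∃ P : ℕ → RatFunc ℚ, P = fun t =>
    ∏ s ∈ Finset.range t, om (a s) (b s) (x s) (y s) (x (s + 1)) (y (s + 1)) := ⟨_, rfl⟩
  obtain ⟨Q, hQ⟩ : ∃ Q : ℕ → RatFunc ℚ, Q = fun t => ∏ s ∈ Finset.Ico t K,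
        om (a s) (b s) (x s + 1) (y s - 1) (x (s + 1) + 1) (y (s + 1) - 1) := ⟨_, rfl⟩
  have hK : K ≠ 0 := by
    rintro rfl
    omega
  have hPs : ∀ t, P (t + 1) = P t * om (a t) (b t) (x t) (y t) (x (t + 1)) (y (t + 1)) := by
    intro t
    rw [hP]
    simp only [Finset.prod_range_succ]
  have hQs : ∀ t, t < K → Q t =
      om (a t) (b t) (x t + 1) (y t - 1) (x (t + 1) + 1) (y (t + 1) - 1) * Q (t + 1) := by
    intro t ht
    rw [hQ]
    simp only
    rw [Finset.prod_eq_prod_Ico_succ_bot ht]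
  have hhS : ∀ t, ∑ s ∈ Finset.range t, (a s - b s) =
      (∑ s ∈ Finset.range t, (A s - B s)) + (x t - y t) := by
    intro t
    induction t with
    | zero => simp [hx0, hy0]
    | succ t ih =>
      rw [Finset.sum_range_succ, Finset.sum_range_succ, ih, hA, hB]
      ring
  have hPx : ∀ t, P t ≠ 0 → (x t = 0 ∨ x t = 1) ∧ (y t = 0 ∨ y t = 1) := by
    intro t ht
    obtain _ | t := t
    · rw [hx0, hy0]; simp
    · rw [hPs] at ht
      have h1 := right_ne_zero_of_mul ht
      unfold om at h1
      split_ifs at h1 with h2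
      · have := ha t
        have := hb t
        omega
      · simp at h1
  have hQx : ∀ t, t ≤ K → Q t ≠ 0 → (x t = -1 ∨ x t = 0) ∧ (y t = 1 ∨ y t = 2) := by
    intro t htK ht
    rcases eq_or_lt_of_le htK with rfl | h
    · rw [hxK, hyK]; simp
    · rw [hQs t h] at ht
      have h1 := left_ne_zero_of_mul ht
      unfold om at h1
      split_ifs at h1 with h2
      · omega
      · simp at h1
  obtain ⟨Z, hZ⟩ : ∃ Z : ℕ → RatFunc ℚ, Z = fun t =>
    v ^ (∑ s ∈ Finset.range t, (A s - B s)) * (P t * Q t) := ⟨_, rfl⟩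
  have hZ0 : Z 0 = 0 := by
    rw [hZ]
    simp only
    rw [hQs 0 (by omega)]
    have : om (a 0) (b 0) (x 0 + 1) (y 0 - 1) (x (0 + 1) + 1) (y (0 + 1) - 1) = 0 := by
      unfold om
      rw [if_neg]
      omega
    rw [this]; ring
  have hZK : Z K = 0 := by
    rw [hZ]
    simp only
    obtain ⟨k, rfl⟩ : ∃ k, K = k + 1 := ⟨K - 1, by omega⟩
    rw [hPs]
    have : om (a k) (b k) (x k) (y k) (x (k + 1)) (y (k + 1)) = 0 := by
      unfold om
      rw [if_neg]
      omega
    rw [this]; ring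
  rw [← sub_eq_zero, ← Finset.sum_sub_distrib]
  have hsum := Finset.sum_range_sub' Z K
  rw [hZ0, hZK, sub_zero] at hsum
  refine Eq.trans ?_ hsum
  apply Finset.sum_congr rfl
  intro t ht
  rw [Finset.mem_range] at ht
  have e1 : (∏ s ∈ Finset.range t, om (a s) (b s) (x s) (y s) (x (s + 1)) (y (s + 1))) = P t := by
    rw [hP]
  have e2 : (∏ s ∈ Finset.Ico (t + 1) K,
        om (a s) (b s) (x s + 1) (y s - 1) (x (s + 1) + 1) (y (s + 1) - 1)) = Q (t + 1) := by
    rw [hQ]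
  rw [e1, e2, hhS t, hZ]
  simp only
  rw [hPs, hQs t ht, Finset.sum_range_succ, zpow_add₀ v_ne, zpow_add₀ v_ne]
  by_cases hp : P t = 0
  · rw [hp]; simp
  by_cases hq : Q (t + 1) = 0
  · rw [hq]; simp
  have hl := om_local (ha t) (hb t) (hA t) (hB t) (hA' t) (hB' t) (hPx t hp).1 (hPx t hp).2
    (hQx (t + 1) ht hq).1 (hQx (t + 1) ht hq).2
  generalize v ^ (∑ s ∈ Finset.range t, (A s - B s)) = V at *
  split_ifs at hl ⊢ <;> linear_combination V * P t * Q (t + 1) * hl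

/-! ### Part 6: the transfer operator weights -/

/-- cumulative sums along runners -/
noncomputable def flow (ℓ N : ℕ) (D : ℤ → ℤ) (c : ℤ) : ℤ :=
  ∑ k ∈ Finset.range (c + N).toNat, D (c - ℓ * k)

theorem flow_low {ℓ N : ℕ} {D : ℤ → ℤ} {c : ℤ} (hc : c ≤ -N) : flow ℓ N D c = 0 := by
  unfold flow
  have : (c + N).toNat = 0 := by omega
  rw [this]; simp

theorem flow_rec {ℓ N : ℕ} (hℓ : 2 ≤ ℓ) {D : ℤ → ℤ} (hD : ∀ c, c ≤ -(N : ℤ) → D c = 0) (c : ℤ) :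
    flow ℓ N D c = flow ℓ N D (c - ℓ) + D c := by
  by_cases hc : c ≤ -N
  · rw [flow_low hc, flow_low (by omega), hD c hc]; rfl
  · unfold flow
    obtain ⟨m, hm⟩ : ∃ m, (c + N).toNat = m + 1 := ⟨(c + N).toNat - 1, by omega⟩
    rw [hm, Finset.sum_range_succ']
    congr 1
    · have hle : (c - ℓ + N).toNat ≤ m := by omega
      rw [← Finset.sum_subset (Finset.range_mono hle)]
      · apply Finset.sum_congr rfl
        intro k _
        congr 1
        push_cast; ring
      · intro k _ hk
        apply hD
        rw [Finset.mem_range] at hk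
        have : (1 : ℤ) * k ≤ ℓ * k := by
          apply mul_le_mul_of_nonneg_right <;> omega
        push_cast
        rw [mul_add]
        omega
    · simp

theorem flow_unique {ℓ N : ℕ} (hℓ : 2 ≤ ℓ) {D X : ℤ → ℤ} (hD : ∀ c, c ≤ -(N : ℤ) → D c = 0)
    (h0 : ∀ c, c ≤ -(N : ℤ) → X c = 0) (hr : ∀ c, X c = X (c - ℓ) + D c) (c : ℤ) :
    flow ℓ N D c = X c := by
  obtain ⟨k, hk⟩ : ∃ k : ℕ, (c + N).toNat = k := ⟨_, rfl⟩
  induction k using Nat.strong_induction_on generalizing c with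
  | _ k ih =>
  by_cases hc : c ≤ -N
  · rw [flow_low hc, h0 c hc]
  · rw [flow_rec hℓ hD, hr, ih (c - ℓ + N).toNat (by omega) (c - ℓ) rfl]

/-- weight of a configuration with given flow -/
noncomputable def Gw (ℓ N : ℕ) (S X : ℤ → ℤ) : RatFunc ℚ :=
  if ∀ c, 0 ≤ X c ∧ X c ≤ S c then
    (-v) ^ (∑ m ∈ Finset.Ico (-N : ℤ) N, (S m - X m) * ∑ h ∈ Finset.Ico (m - ℓ + 1) m, X h) else 0

/-- matrix coefficients of the transfer operator -/
noncomputable def W (ℓ N : ℕ) (S T : YoungDiagram) : RatFunc ℚ :=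
  Gw ℓ N (occ S) (flow ℓ N (fun c => occ S c - occ T c))

/-- content not of color `i`, `i+1` -/
def Off (ℓ : ℕ) (i : ZMod ℓ) (c : ℤ) : Prop := (c : ZMod ℓ) ≠ i ∧ (c : ZMod ℓ) ≠ i + 1

/-- part of the exponent not changed by moves of color `i` -/
noncomputable def restE (ℓ : ℕ) (i : ZMod ℓ) (N : ℕ) (S X : ℤ → ℤ) (s : ℕ) : ℤ :=
  (S (lev ℓ i N s) + S (lev ℓ i N s + 1) - (X (lev ℓ i N s) + X (lev ℓ i N s + 1))) *
    (∑ h ∈ Finset.Ico (lev ℓ i N s - ℓ + 2) (lev ℓ i N s), X h) +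
  ∑ m ∈ Finset.Ico (lev ℓ i N s + 2) (lev ℓ i N s + ℓ), (S m - X m) *
    ((∑ h ∈ Finset.Ico (m - ℓ + 1) (lev ℓ i N s), X h) + (X (lev ℓ i N s) + X (lev ℓ i N s + 1)) +
     ∑ h ∈ Finset.Ico (lev ℓ i N s + 2) m, X h)

/-- factor not changed by moves of color `i` -/
noncomputable def kap (ℓ : ℕ) (i : ZMod ℓ) (N : ℕ) (S X : ℤ → ℤ) : RatFunc ℚ :=
  if ∀ c, Off ℓ i c → 0 ≤ X c ∧ X c ≤ S c then
    (-v) ^ (∑ s ∈ Finset.range (2 * N), restE ℓ i N S X s) else 0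

theorem intCast_ne {ℓ : ℕ} {d : ℤ} (h1 : 0 < d) (h2 : d < ℓ) : (d : ZMod ℓ) ≠ 0 := by
  rw [Ne, ZMod.intCast_zmod_eq_zero_iff_dvd]
  intro h
  have := Int.le_of_dvd h1 h
  omega

theorem off_of {ℓ : ℕ} (hℓ : 2 ≤ ℓ) {i : ZMod ℓ} {N s : ℕ} {c : ℤ} (h1 : lev ℓ i N s + 2 ≤ c)
    (h2 : c < lev ℓ i N s + ℓ) : Off ℓ i c := by
  constructor
  · intro h
    apply intCast_ne (ℓ := ℓ) (d := c - lev ℓ i N s) (by omega) (by omega)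
    push_cast
    rw [lev_color hℓ, h, sub_self]
  · intro h
    apply intCast_ne (ℓ := ℓ) (d := c - lev ℓ i N s - 1) (by omega) (by omega)
    push_cast
    rw [lev_color hℓ, h]; ring

theorem off_of' {ℓ : ℕ} (hℓ : 2 ≤ ℓ) {i : ZMod ℓ} {N s : ℕ} {c : ℤ}
    (h1 : lev ℓ i N s - ℓ + 2 ≤ c) (h2 : c < lev ℓ i N s) : Off ℓ i c := by
  constructor
  · intro h
    apply intCast_ne (ℓ := ℓ) (d := c + ℓ - lev ℓ i N s) (by omega) (by omega)
    push_cast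
    rw [lev_color hℓ, h]; simp
  · intro h
    apply intCast_ne (ℓ := ℓ) (d := c + ℓ - lev ℓ i N s - 1) (by omega) (by omega)
    push_cast
    rw [lev_color hℓ, h]; simp

theorem kap_congr {ℓ : ℕ} (hℓ : 2 ≤ ℓ) {i : ZMod ℓ} {N : ℕ} {S X S' X' : ℤ → ℤ}
    (hS : ∀ c, Off ℓ i c → S' c = S c) (hX : ∀ c, Off ℓ i c → X' c = X c)
    (hS2 : ∀ s, S' (lev ℓ i N s) + S' (lev ℓ i N s + 1) = S (lev ℓ i N s) + S (lev ℓ i N s + 1))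
    (hX2 : ∀ s, X' (lev ℓ i N s) + X' (lev ℓ i N s + 1) = X (lev ℓ i N s) + X (lev ℓ i N s + 1)) :
    kap ℓ i N S' X' = kap ℓ i N S X := by
  have h1 : (∀ c, Off ℓ i c → 0 ≤ X' c ∧ X' c ≤ S' c) ↔ (∀ c, Off ℓ i c → 0 ≤ X c ∧ X c ≤ S c) := by
    constructor
    · intro h c hc
      rw [← hS c hc, ← hX c hc]; exact h c hc
    · intro h c hc
      rw [hS c hc, hX c hc]; exact h c hc
  have h2 : ∀ s, restE ℓ i N S' X' s = restE ℓ i N S X s := by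
    intro s
    unfold restE
    rw [hS2, hX2]
    congr 1
    · congr 1
      apply Finset.sum_congr rfl
      intro h hh
      rw [Finset.mem_Ico] at hh
      exact hX h (off_of' hℓ hh.1 hh.2)
    · apply Finset.sum_congr rfl
      intro m hm
      rw [Finset.mem_Ico] at hm
      have hmo := off_of hℓ hm.1 hm.2
      rw [hS m hmo, hX m hmo]
      congr 2
      · congr 1
        apply Finset.sum_congr rfl
        intro h hh
        rw [Finset.mem_Ico] at hh
        exact hX h (off_of' hℓ (s := s) (N := N) (by omega) hh.2)
      · apply Finset.sum_congr rfl
        intro h hh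
        rw [Finset.mem_Ico] at hh
        exact hX h (off_of hℓ (s := s) (N := N) hh.1 (by omega))
  unfold kap
  rw [Finset.sum_congr rfl (fun s _ => h2 s)]
  by_cases hc : ∀ c, Off ℓ i c → 0 ≤ X c ∧ X c ≤ S c
  · rw [if_pos hc, if_pos (h1.2 hc)]
  · rw [if_neg hc, if_neg (fun hh => hc (h1.1 hh))]

theorem sumIco_split (f : ℤ → ℤ) {a b c : ℤ} (h1 : a ≤ b) (h2 : b ≤ c) :
    ∑ m ∈ Finset.Ico a c, f m = (∑ m ∈ Finset.Ico a b, f m) + ∑ m ∈ Finset.Ico b c, f m := by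
  rw [← Finset.Ico_union_Ico_eq_Ico h1 h2, Finset.sum_union]
  exact Finset.Ico_disjoint_Ico_consecutive a b c

theorem sumIco_one (f : ℤ → ℤ) (a : ℤ) : ∑ m ∈ Finset.Ico a (a + 1), f m = f a := by
  have : Finset.Ico a (a + 1) = {a} := by
    ext x; simp; omega
  rw [this, Finset.sum_singleton]

theorem lev_succ (ℓ : ℕ) (i : ZMod ℓ) (N s : ℕ) : lev ℓ i N (s + 1) = lev ℓ i N s + ℓ := by
  unfold lev; push_cast; ring

theorem sumIco_lev (ℓ : ℕ) (i : ZMod ℓ) (N : ℕ) (f : ℤ → ℤ) (L : ℕ) :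
    ∑ m ∈ Finset.Ico (lev ℓ i N 0) (lev ℓ i N L), f m =
      ∑ s ∈ Finset.range L, ∑ m ∈ Finset.Ico (lev ℓ i N s) (lev ℓ i N s + ℓ), f m := by
  induction L with
  | zero => simp
  | succ L ih =>
    rw [Finset.sum_range_succ, ← ih, lev_succ, sumIco_split f (b := lev ℓ i N L)]
    · unfold lev
      push_cast
      have : (0 : ℤ) ≤ ℓ * L := by positivity
      linarith
    · omega

theorem level_exp {ℓ : ℕ} (hℓ : 2 ≤ ℓ) (i : ZMod ℓ) (N : ℕ) (S X : ℤ → ℤ) (s : ℕ) :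
    ∑ m ∈ Finset.Ico (lev ℓ i N s) (lev ℓ i N s + ℓ),
      (S m - X m) * ∑ h ∈ Finset.Ico (m - ℓ + 1) m, X h =
    restE ℓ i N S X s +
    ((S (lev ℓ i N s) - X (lev ℓ i N s)) * X (lev ℓ i N s + 1 - ℓ) +
      (S (lev ℓ i N s + 1) - X (lev ℓ i N s + 1)) * X (lev ℓ i N s)) := by
  unfold restE
  generalize lev ℓ i N s = c
  rw [sumIco_split _ (b := c + 1) (by omega) (by omega), sumIco_one,
    sumIco_split _ (a := c + 1) (b := c + 1 + 1) (by omega) (by omega), sumIco_one]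
  rw [sumIco_split X (a := c - ℓ + 1) (b := c - ℓ + 1 + 1) (by omega) (by omega), sumIco_one]
  rw [sumIco_split X (a := c + 1 - ℓ + 1) (b := c) (c := c + 1) (by omega) (by omega), sumIco_one]
  have e1 : ∑ m ∈ Finset.Ico (c + 1 + 1) (c + ℓ), (S m - X m) * ∑ h ∈ Finset.Ico (m - ℓ + 1) m, X h
      = ∑ m ∈ Finset.Ico (c + 2) (c + ℓ), (S m - X m) *
    ((∑ h ∈ Finset.Ico (m - ℓ + 1) c, X h) + (X c + X (c + 1)) +
     ∑ h ∈ Finset.Ico (c + 2) m, X h) := by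
    rw [show c + 1 + 1 = c + 2 by ring]
    apply Finset.sum_congr rfl
    intro m hm
    rw [Finset.mem_Ico] at hm
    rw [sumIco_split X (a := m - ℓ + 1) (b := c) (by omega) (by omega),
      sumIco_split X (a := c) (b := c + 1) (by omega) (by omega), sumIco_one,
      sumIco_split X (a := c + 1) (b := c + 1 + 1) (by omega) (by omega), sumIco_one,
      show c + 1 + 1 = c + 2 by ring]
    ring
  rw [e1, show c - ℓ + 1 + 1 = c - ℓ + 2 by ring, show c + 1 - (ℓ : ℤ) + 1 = c - ℓ + 2 by ring,
    show c - (ℓ : ℤ) + 1 = c + 1 - ℓ by ring]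
  ring

theorem prod_zpow_sum {ι : Type*} (s : Finset ι) (f : ι → ℤ) :
    ∏ t ∈ s, (-v) ^ (f t) = (-v) ^ (∑ t ∈ s, f t) := by
  induction s using Finset.induction_on with
  | empty => simp
  | insert a s ha ih =>
    rw [Finset.prod_insert ha, Finset.sum_insert ha, zpow_add₀ (neg_ne_zero.2 v_ne), ih]

theorem lev_zero_le {ℓ : ℕ} (hℓ : 2 ≤ ℓ) (i : ZMod ℓ) {N : ℕ} (hN : 1 ≤ N) :
    lev ℓ i N 0 ≤ -N ∧ (N : ℤ) ≤ lev ℓ i N (2 * N) := by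
  have : NeZero ℓ := ⟨by omega⟩
  have hlt : (i.val : ℤ) < ℓ := by exact_mod_cast ZMod.val_lt i
  unfold lev
  have h2 : (2 : ℤ) ≤ ℓ := by exact_mod_cast hℓ
  have h3 : (1 : ℤ) ≤ N := by exact_mod_cast hN
  push_cast
  constructor
  · nlinarith
  · have : (0 : ℤ) ≤ i.val := by omega
    nlinarith

theorem Gw_factor {ℓ : ℕ} (hℓ : 2 ≤ ℓ) (i : ZMod ℓ) {N : ℕ} (hN : 1 ≤ N) {S X : ℤ → ℤ}
    (hS1 : ∀ c, S c = 0 ∨ S c = 1) (hS0 : ∀ c, (N : ℤ) - 1 ≤ c → S c = 0)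
    (hX0 : ∀ c, c ≤ -(N : ℤ) + 1 → X c = 0)
    (hXr : ∀ c, (N : ℤ) - 1 ≤ c → X c = X (c - ℓ)) :
    Gw ℓ N S X = kap ℓ i N S X * ∏ s ∈ Finset.range (2 * N),
      om (S (lev ℓ i N s)) (S (lev ℓ i N s + 1)) (X (lev ℓ i N s - ℓ)) (X (lev ℓ i N s + 1 - ℓ))
        (X (lev ℓ i N s)) (X (lev ℓ i N s + 1)) := by
  by_cases hval : ∀ c, 0 ≤ X c ∧ X c ≤ S c
  · unfold Gw kap
    rw [if_pos hval, if_pos (fun c _ => hval c)]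
    have e1 : ∀ s ∈ Finset.range (2 * N), om (S (lev ℓ i N s)) (S (lev ℓ i N s + 1))
        (X (lev ℓ i N s - ℓ)) (X (lev ℓ i N s + 1 - ℓ)) (X (lev ℓ i N s)) (X (lev ℓ i N s + 1)) =
        (-v) ^ ((S (lev ℓ i N s) - X (lev ℓ i N s)) * X (lev ℓ i N s + 1 - ℓ) +
      (S (lev ℓ i N s + 1) - X (lev ℓ i N s + 1)) * X (lev ℓ i N s)) := by
      intro s _
      unfold om
      rw [if_pos]
      have h1 := hval (lev ℓ i N s - ℓ)
      have h2 := hS1 (lev ℓ i N s - ℓ)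
      have h3 := hval (lev ℓ i N s + 1 - ℓ)
      have h4 := hS1 (lev ℓ i N s + 1 - ℓ)
      exact ⟨by omega, by omega, hval _, hval _⟩
    rw [Finset.prod_congr rfl e1, prod_zpow_sum, ← zpow_add₀ (neg_ne_zero.2 v_ne),
      ← Finset.sum_add_distrib, ← Finset.sum_congr rfl (fun s _ => level_exp hℓ i N S X s),
      ← sumIco_lev]
    congr 1
    have hl := lev_zero_le hℓ i hN
    apply Finset.sum_subset (Finset.Ico_subset_Ico hl.1 hl.2)
    intro m hm hm'
    rw [Finset.mem_Ico] at hm'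
    rcases lt_or_ge m (-(N : ℤ)) with h | h
    · rw [Finset.sum_eq_zero, mul_zero]
      intro c hc
      rw [Finset.mem_Ico] at hc
      exact hX0 c (by omega)
    · have h1 := hS0 m (by omega)
      have h2 := hval m
      have : S m - X m = 0 := by omega
      rw [this, zero_mul]
  · have hL : Gw ℓ N S X = 0 := by unfold Gw; rw [if_neg hval]
    rw [hL]
    symm
    by_contra hne
    apply hval
    have hk := left_ne_zero_of_mul hne
    have hp := right_ne_zero_of_mul hne
    have hoff : ∀ c, Off ℓ i c → 0 ≤ X c ∧ X c ≤ S c := by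
      unfold kap at hk
      by_contra hc
      rw [if_neg hc] at hk
      exact hk rfl
    have hlev : ∀ s, s < 2 * N → (0 ≤ X (lev ℓ i N s) ∧ X (lev ℓ i N s) ≤ S (lev ℓ i N s)) ∧
        (0 ≤ X (lev ℓ i N s + 1) ∧ X (lev ℓ i N s + 1) ≤ S (lev ℓ i N s + 1)) := by
      intro s hs
      have := (Finset.prod_ne_zero_iff.1 hp) s (Finset.mem_range.2 hs)
      unfold om at this
      split_ifs at this with h
      · exact ⟨h.2.2.1, h.2.2.2⟩
      · simp at this
    have hbig : ∀ s, 2 * N ≤ s + 1 → (N : ℤ) - 1 ≤ lev ℓ i N s := by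
      intro s hs
      unfold lev
      have h2 : (2 : ℤ) ≤ ℓ := by exact_mod_cast hℓ
      have h3 : (1 : ℤ) ≤ N := by exact_mod_cast hN
      have h4 : (2 : ℤ) * N - 1 ≤ s := by omega
      have h5 : (0 : ℤ) ≤ i.val := by omega
      nlinarith
    have key : ∀ s, (0 ≤ X (lev ℓ i N s) ∧ X (lev ℓ i N s) ≤ S (lev ℓ i N s)) ∧
        (0 ≤ X (lev ℓ i N s + 1) ∧ X (lev ℓ i N s + 1) ≤ S (lev ℓ i N s + 1)) := by
      intro s
      induction s with
      | zero => exact hlev 0 (by omega)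
      | succ s ih =>
        by_cases hs : s + 1 < 2 * N
        · exact hlev _ hs
        · have h1 := hbig s (by omega)
          have h2 := hbig (s + 1) (by omega)
          rw [hXr _ h2, hXr (lev ℓ i N (s + 1) + 1) (by omega), hS0 _ h2,
            hS0 (lev ℓ i N (s + 1) + 1) (by omega), lev_succ]
          rw [hS0 _ h1, hS0 (lev ℓ i N s + 1) (by omega)] at ih
          rw [show lev ℓ i N s + ℓ - ℓ = lev ℓ i N s by ring,
            show lev ℓ i N s + ℓ + 1 - ℓ = lev ℓ i N s + 1 by ring]
          exact ih
    have hl0 := (lev_zero_le hℓ i hN).1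
    intro c
    by_cases hlow : c ≤ -(N : ℤ) + 1
    · rw [hX0 c hlow]
      have := hS1 c
      omega
    · by_cases h1 : (c : ZMod ℓ) = i
      · obtain ⟨s, rfl⟩ := exists_lev' (N := N) (s := 0) hℓ h1 (by omega)
        exact (key s).1
      · by_cases h2 : (c : ZMod ℓ) = i + 1
        · obtain ⟨s, hc'⟩ := exists_lev' (i := i) (N := N) (s := 0) (c := c - 1) hℓ
            (by push_cast; rw [h2]; ring) (by omega)
          have := (key s).2
          rw [hc', sub_add_cancel] at this
          exact this
        · exact hoff c ⟨h1, h2⟩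

/-! ### Part 7: the transfer operator commutes with the lowering operators -/

/-- flow difference of two diagrams -/
noncomputable def fl (ℓ N : ℕ) (S T : YoungDiagram) : ℤ → ℤ :=
  flow ℓ N (fun c => occ S c - occ T c)

theorem fl_rec {ℓ : ℕ} (hℓ : 2 ≤ ℓ) {n N : ℕ} (hN : n ≤ N) {S T : YoungDiagram}
    (hS : S.card ≤ n) (hT : T.card ≤ n) (c : ℤ) :
    fl ℓ N S T c = fl ℓ N S T (c - ℓ) + (occ S c - occ T c) := by
  unfold fl
  apply flow_rec hℓ (D := fun c => occ S c - occ T c)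
  intro c hc
  rw [occ_low_card hS (by omega), occ_low_card hT (by omega), sub_self]

theorem fl_low {ℓ : ℕ} (hℓ : 2 ≤ ℓ) {n N : ℕ} (hN : n ≤ N) {S T : YoungDiagram}
    (hS : S.card ≤ n) (hT : T.card ≤ n) {c : ℤ} (hc : c ≤ -(n : ℤ)) : fl ℓ N S T c = 0 := by
  obtain ⟨k, hk⟩ : ∃ k : ℕ, (c + N).toNat = k := ⟨_, rfl⟩
  induction k using Nat.strong_induction_on generalizing c with
  | _ k ih =>
  by_cases hc' : c ≤ -N
  · exact flow_low hc'
  · rw [fl_rec hℓ hN hS hT, ih (c - ℓ + N).toNat (by omega) (by omega) rfl,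
      occ_low_card hS hc, occ_low_card hT hc]; rfl

theorem fl_high {ℓ : ℕ} (hℓ : 2 ≤ ℓ) {n N : ℕ} (hN : n ≤ N) {S T : YoungDiagram}
    (hS : S.card ≤ n) (hT : T.card ≤ n) {c : ℤ} (hc : (n : ℤ) < c) :
    fl ℓ N S T c = fl ℓ N S T (c - ℓ) := by
  rw [fl_rec hℓ hN hS hT, occ_high_card hS hc, occ_high_card hT hc]; ring

theorem step_aux {ℓ : ℕ} (hℓ : 2 ≤ ℓ) {a c : ℤ} (h : (ℓ : ℤ) ∣ c - a) :
    (if a ≤ c then (1 : ℤ) else 0) = (if a ≤ c - ℓ then 1 else 0) + (if c = a then 1 else 0) := by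
  obtain ⟨k, hk⟩ := h
  have h2 : (2 : ℤ) ≤ ℓ := by exact_mod_cast hℓ
  rcases lt_trichotomy k 0 with h | rfl | h
  · have : c - a < 0 := by nlinarith
    rw [if_neg (by omega), if_neg (by omega), if_neg (by omega)]; rfl
  · rw [mul_zero] at hk
    rw [if_pos (by omega), if_neg (by omega), if_pos (by omega)]; rfl
  · have : c - a ≥ ℓ := by nlinarith
    rw [if_pos (by omega), if_pos (by omega), if_neg (by omega)]; rfl

/-- modified flow -/
noncomputable def Xm (ℓ : ℕ) (i : ZMod ℓ) (N : ℕ) (X : ℤ → ℤ) (t : ℕ) (c : ℤ) : ℤ :=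
  X c + (if (c : ZMod ℓ) = i then (if lev ℓ i N t ≤ c then 1 else 0) else 0)
    - (if (c : ZMod ℓ) = i + 1 then (if lev ℓ i N t + 1 ≤ c then 1 else 0) else 0)

theorem col_ne {ℓ : ℕ} (hℓ : 2 ≤ ℓ) (i : ZMod ℓ) : i ≠ i + 1 := by
  have : Fact (1 < ℓ) := ⟨by omega⟩
  intro h
  have h2 : (1 : ZMod ℓ) = 0 := by simp at h
  exact one_ne_zero h2

theorem Xm_rec {ℓ : ℕ} (hℓ : 2 ≤ ℓ) {i : ZMod ℓ} {N : ℕ} {X D : ℤ → ℤ} {t : ℕ} {c : ℤ}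
    (hr : X c = X (c - ℓ) + D c) :
    Xm ℓ i N X t c = Xm ℓ i N X t (c - ℓ) +
      (D c + (if c = lev ℓ i N t then 1 else 0) - (if c = lev ℓ i N t + 1 then 1 else 0)) := by
  have hcast : ((c - ℓ : ℤ) : ZMod ℓ) = (c : ZMod ℓ) := by push_cast; simp
  unfold Xm
  rw [hcast, hr]
  by_cases h1 : (c : ZMod ℓ) = i
  · have h2 : ¬ (c : ZMod ℓ) = i + 1 := by rw [h1]; exact col_ne hℓ i
    rw [if_pos h1, if_pos h1, if_neg h2, if_neg h2]
    have h3 : c ≠ lev ℓ i N t + 1 := by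
      rintro rfl
      apply h2
      push_cast
      rw [lev_color hℓ]
    rw [if_neg h3, step_aux hℓ (a := lev ℓ i N t) (c := c)]
    · ring
    · rw [← ZMod.intCast_zmod_eq_zero_iff_dvd]
      push_cast
      rw [h1, lev_color hℓ, sub_self]
  · rw [if_neg h1, if_neg h1]
    have h3 : c ≠ lev ℓ i N t := by
      rintro rfl
      apply h1
      rw [lev_color hℓ]
    rw [if_neg h3]
    by_cases h2 : (c : ZMod ℓ) = i + 1
    · rw [if_pos h2, if_pos h2, step_aux hℓ (a := lev ℓ i N t + 1) (c := c)]
      · ring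
      · rw [← ZMod.intCast_zmod_eq_zero_iff_dvd]
        push_cast
        rw [h2, lev_color hℓ, sub_self]
    · rw [if_neg h2, if_neg h2]
      have h4 : c ≠ lev ℓ i N t + 1 := by
        rintro rfl
        apply h2
        push_cast
        rw [lev_color hℓ]
      rw [if_neg h4]
      ring

theorem lev_le {ℓ : ℕ} (hℓ : 2 ≤ ℓ) {i : ZMod ℓ} {N s t : ℕ} :
    lev ℓ i N t ≤ lev ℓ i N s ↔ t ≤ s := by
  rw [← not_lt, ← not_lt, lev_lt hℓ]

theorem Xm_lev {ℓ : ℕ} (hℓ : 2 ≤ ℓ) {i : ZMod ℓ} {N : ℕ} {X : ℤ → ℤ} {t : ℕ} (s : ℕ) :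
    Xm ℓ i N X t (lev ℓ i N s) = X (lev ℓ i N s) + (if t ≤ s then 1 else 0) ∧
    Xm ℓ i N X t (lev ℓ i N s + 1) = X (lev ℓ i N s + 1) - (if t ≤ s then 1 else 0) ∧
    Xm ℓ i N X t (lev ℓ i N s - ℓ) = X (lev ℓ i N s - ℓ) + (if t < s then 1 else 0) ∧
    Xm ℓ i N X t (lev ℓ i N s + 1 - ℓ) = X (lev ℓ i N s + 1 - ℓ) - (if t < s then 1 else 0) := by
  have hne := col_ne hℓ i
  have e2 : ((lev ℓ i N s + 1 : ℤ) : ZMod ℓ) = i + 1 := by push_cast; rw [lev_color hℓ]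
  have e3 : ((lev ℓ i N s - ℓ : ℤ) : ZMod ℓ) = i := by push_cast; rw [lev_color hℓ]; simp
  have e4 : ((lev ℓ i N s + 1 - ℓ : ℤ) : ZMod ℓ) = i + 1 := by push_cast; rw [lev_color hℓ]; simp
  have hlt : lev ℓ i N t ≤ lev ℓ i N s - ℓ ↔ t < s := by
    obtain _ | s := s
    · constructor
      · intro h
        have h1 := (lev_le hℓ (i := i) (N := N) (t := 0) (s := t)).2 (by omega)
        omega
      · omega
    · rw [lev_succ, add_sub_cancel_right, lev_le hℓ]; omega
  unfold Xm
  rw [lev_color hℓ, e2, e3, e4]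
  refine ⟨?_, ?_, ?_, ?_⟩
  · rw [if_pos rfl, if_neg hne]; simp only [lev_le hℓ, sub_zero]
  · rw [if_pos rfl, if_neg hne.symm]; simp only [add_le_add_iff_right, lev_le hℓ, add_zero]
  · rw [if_pos rfl, if_neg hne]; simp only [hlt, sub_zero]
  · rw [if_pos rfl, if_neg hne.symm]
    have : lev ℓ i N t + 1 ≤ lev ℓ i N s + 1 - ℓ ↔ t < s := by rw [← hlt]; omega
    simp only [this, add_zero]

theorem Xm_off {ℓ : ℕ} {i : ZMod ℓ} {N : ℕ} {X : ℤ → ℤ} {t : ℕ} {c : ℤ} (h : Off ℓ i c) :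
    Xm ℓ i N X t c = X c := by
  unfold Xm
  rw [if_neg h.1, if_neg h.2]; ring

theorem W_mod {ℓ : ℕ} (hℓ : 2 ≤ ℓ) (i : ZMod ℓ) {n N : ℕ} (hN : n + 3 ≤ N) {S T S' T' : YoungDiagram}
    (hS : S.card ≤ n + 1) (hT : T.card ≤ n + 1) (hS' : S'.card ≤ n + 1) (hT' : T'.card ≤ n + 1)
    {t : ℕ} (hD : ∀ c, occ S' c - occ T' c = occ S c - occ T c +
      (if c = lev ℓ i N t then 1 else 0) - (if c = lev ℓ i N t + 1 then 1 else 0))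
    (hoff : ∀ c, Off ℓ i c → occ S' c = occ S c)
    (hpair : ∀ s, occ S' (lev ℓ i N s) + occ S' (lev ℓ i N s + 1) =
      occ S (lev ℓ i N s) + occ S (lev ℓ i N s + 1)) :
    W ℓ N S' T' = kap ℓ i N (occ S) (fl ℓ N S T) * ∏ s ∈ Finset.range (2 * N),
      om (occ S' (lev ℓ i N s)) (occ S' (lev ℓ i N s + 1))
        (fl ℓ N S T (lev ℓ i N s - ℓ) + (if t < s then 1 else 0))
        (fl ℓ N S T (lev ℓ i N s + 1 - ℓ) - (if t < s then 1 else 0))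
        (fl ℓ N S T (lev ℓ i N s) + (if t ≤ s then 1 else 0))
        (fl ℓ N S T (lev ℓ i N s + 1) - (if t ≤ s then 1 else 0)) := by
  have hX : fl ℓ N S' T' = Xm ℓ i N (fl ℓ N S T) t := by
    have hr : ∀ c, Xm ℓ i N (fl ℓ N S T) t c = Xm ℓ i N (fl ℓ N S T) t (c - ℓ) +
        (occ S' c - occ T' c) := by
      intro c
      rw [hD]
      exact Xm_rec hℓ (D := fun c => occ S c - occ T c) (fl_rec hℓ (by omega) hS hT c)
    have hl : ∀ c ≤ -(N : ℤ), Xm ℓ i N (fl ℓ N S T) t c = 0 := by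
      by_cases ht : -(N : ℤ) < lev ℓ i N t
      · intro c hc
        unfold Xm
        rw [fl_low hℓ (n := n + 1) (by omega) hS hT (by push_cast; omega)]
        split_ifs <;> first | omega | rfl
      · exfalso
        have h1 := hD (lev ℓ i N t)
        rw [if_pos rfl, if_neg (by omega), occ_low_card hS (by push_cast; omega),
          occ_low_card hT (by push_cast; omega), occ_low_card hS' (by push_cast; omega),
          occ_low_card hT' (by push_cast; omega)] at h1
        omega
    funext c
    refine flow_unique hℓ (D := fun c => occ S' c - occ T' c) ?_ hl hr c
    intro c hc
    rw [occ_low_card hS' (by push_cast; omega), occ_low_card hT' (by push_cast; omega), sub_self]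
  have h1 : W ℓ N S' T' = Gw ℓ N (occ S') (fl ℓ N S' T') := rfl
  rw [h1, Gw_factor hℓ i (by omega) (occ_bit S')
    (fun c hc => occ_high_card hS' (by push_cast; omega))
    (fun c hc => fl_low hℓ (n := n + 1) (by omega) hS' hT' (by push_cast; omega))
    (fun c hc => fl_high hℓ (n := n + 1) (by omega) hS' hT' (by push_cast; omega)), hX]
  congr 1
  · apply kap_congr hℓ hoff (fun c hc => Xm_off hc) hpair
    intro s
    rw [(Xm_lev hℓ s).1, (Xm_lev hℓ s).2.1]; ring
  · apply Finset.prod_congr rfl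
    intro s _
    obtain ⟨e1, e2, e3, e4⟩ := Xm_lev hℓ (i := i) (N := N) (X := fl ℓ N S T) (t := t) s
    rw [e1, e2, e3, e4]

theorem prod_three (f : ℕ → RatFunc ℚ) {t K : ℕ} (ht : t < K) :
    ∏ s ∈ Finset.range K, f s = (∏ s ∈ Finset.range t, f s) * f t * ∏ s ∈ Finset.Ico (t + 1) K, f s := by
  rw [← Finset.prod_range_mul_prod_Ico f ht.le, Finset.prod_eq_prod_Ico_succ_bot ht, mul_assoc]

theorem core {ℓ : ℕ} (hℓ : 2 ≤ ℓ) (i : ZMod ℓ) {n N : ℕ} (hN : n + 3 ≤ N) {S T : YoungDiagram}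
    (hS : S.card ≤ n) (hT : T.card ≤ n) :
    ∑ t ∈ Finset.range (2 * N), (if Ad T (lev ℓ i N t) then
      v ^ (hgt ℓ i N T t) * W ℓ N S (up T (lev ℓ i N t)) else 0) =
    ∑ t ∈ Finset.range (2 * N), (if Rm S (lev ℓ i N t) then
      v ^ (hgt ℓ i N S t) * W ℓ N (dn S (lev ℓ i N t)) T else 0) := by
  obtain ⟨X, hX⟩ : ∃ X, X = fl ℓ N S T := ⟨_, rfl⟩
  obtain ⟨κ, hκ⟩ : ∃ κ, κ = kap ℓ i N (occ S) X := ⟨_, rfl⟩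
  have hL : ∀ t, Ad T (lev ℓ i N t) → W ℓ N S (up T (lev ℓ i N t)) =
      κ * ∏ s ∈ Finset.range (2 * N),
      om (occ S (lev ℓ i N s)) (occ S (lev ℓ i N s + 1))
        (X (lev ℓ i N s - ℓ) + (if t < s then 1 else 0))
        (X (lev ℓ i N s + 1 - ℓ) - (if t < s then 1 else 0))
        (X (lev ℓ i N s) + (if t ≤ s then 1 else 0))
        (X (lev ℓ i N s + 1) - (if t ≤ s then 1 else 0)) := by
    intro t ht
    obtain ⟨ν, b, hc, hb⟩ := ad_iff.1 ht
    have hu := up_eq hc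
    rw [hb] at hu
    have hcard := cov_card hc
    rw [hu, hκ, hX]
    apply W_mod hℓ i hN (by omega) (by omega) (by omega) (by omega)
    · intro c
      rw [cov_occ hc, hb]; ring
    · intro c _; rfl
    · intro s; rfl
  have hR : ∀ t, Rm S (lev ℓ i N t) → W ℓ N (dn S (lev ℓ i N t)) T =
      κ * ∏ s ∈ Finset.range (2 * N),
      om (if s = t then 1 else occ S (lev ℓ i N s)) (if s = t then 0 else occ S (lev ℓ i N s + 1))
        (X (lev ℓ i N s - ℓ) + (if t < s then 1 else 0))
        (X (lev ℓ i N s + 1 - ℓ) - (if t < s then 1 else 0))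
        (X (lev ℓ i N s) + (if t ≤ s then 1 else 0))
        (X (lev ℓ i N s + 1) - (if t ≤ s then 1 else 0)) := by
    intro t ht
    obtain ⟨μ, b, hc, hb⟩ := rm_iff.1 ht
    have hu := dn_eq hc
    rw [hb] at hu
    have hcard := cov_card hc
    have hocc : ∀ c, occ μ c = occ S c + (if c = lev ℓ i N t then 1 else 0)
        - (if c = lev ℓ i N t + 1 then 1 else 0) := by
      intro c
      rw [cov_occ hc, hb]; ring
    have o1 : ∀ s, occ μ (lev ℓ i N s) = if s = t then 1 else occ S (lev ℓ i N s) := by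
      intro s
      rw [hocc, if_neg (lev_ne_succ hℓ i N s t)]
      by_cases h : s = t
      · subst h
        rw [if_pos rfl, if_pos rfl, ht.1]; rfl
      · rw [if_neg (fun hh => h (lev_inj hℓ hh)), if_neg h]; ring
    have o2 : ∀ s, occ μ (lev ℓ i N s + 1) = if s = t then 0 else occ S (lev ℓ i N s + 1) := by
      intro s
      rw [hocc, if_neg (fun hh => lev_ne_succ hℓ i N t s hh.symm)]
      by_cases h : s = t
      · subst h
        rw [if_pos rfl, if_pos rfl, ht.2]; rfl
      · rw [if_neg (fun hh => h (lev_inj (i := i) (N := N) hℓ (by omega))), if_neg h]; ring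
    rw [hu, W_mod hℓ i hN (S := S) (T := T) (t := t) (by omega) (by omega) (by omega) (by omega), hκ, hX]
    · congr 1
      apply Finset.prod_congr rfl
      intro s _
      rw [o1, o2]
    · intro c
      rw [hocc]; ring
    · intro c hoff
      rw [hocc, if_neg, if_neg]
      · ring
      · rintro rfl
        apply hoff.2
        push_cast
        rw [lev_color hℓ]
      · rintro rfl
        apply hoff.1
        rw [lev_color hℓ]
    · intro s
      rw [o1, o2]
      split_ifs with h
      · subst h
        rw [ht.1, ht.2]; rfl
      · rfl
  have hxs : ∀ s, lev ℓ i N (s + 1) - ℓ = lev ℓ i N s := by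
    intro s; rw [lev_succ]; ring
  have hys : ∀ s, lev ℓ i N (s + 1) + 1 - ℓ = lev ℓ i N s + 1 := by
    intro s; rw [lev_succ]; ring
  have hlast : (N : ℤ) - 1 ≤ lev ℓ i N (2 * N - 1) := by
    have h1 := (lev_zero_le hℓ i (N := N) (by omega)).2
    unfold lev
    have h2 : (2 : ℤ) ≤ ℓ := by exact_mod_cast hℓ
    have h3 : (1 : ℤ) ≤ N := by omega
    have h4 : ((2 * N - 1 : ℕ) : ℤ) = 2 * N - 1 := by omega
    rw [h4]
    have h5 : (0 : ℤ) ≤ i.val := by omega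
    nlinarith
  have hzS : ∀ c, (N : ℤ) - 1 ≤ c → occ S c = 0 := fun c hc => occ_high_card hS (by omega)
  by_cases hend : X (lev ℓ i N (2 * N) - ℓ) = -1 ∧ X (lev ℓ i N (2 * N) + 1 - ℓ) = 1
  · have hrec : ∀ c, X c = X (c - ℓ) + (occ S c - occ T c) := by
      rw [hX]; exact fl_rec hℓ (by omega) hS hT
    have hl0 := (lev_zero_le hℓ i (N := N) (by omega)).1
    have tel := telescope (2 * N) (fun s => occ S (lev ℓ i N s)) (fun s => occ S (lev ℓ i N s + 1))
      (fun s => X (lev ℓ i N s - ℓ)) (fun s => X (lev ℓ i N s + 1 - ℓ))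
      (fun s => occ T (lev ℓ i N s)) (fun s => occ T (lev ℓ i N s + 1))
      (fun s => occ_bit _ _) (fun s => occ_bit _ _)
      (fun s => by rw [hxs, hrec (lev ℓ i N s)]; ring)
      (fun s => by rw [hys, hrec (lev ℓ i N s + 1)]; ring)
      (fun s => occ_bit _ _) (fun s => occ_bit _ _)
      (by rw [hX]; exact fl_low hℓ (n := n) (by omega) hS hT (by omega))
      (by rw [hX]; exact fl_low hℓ (n := n) (by omega) hS hT (by omega))
      hend.1 hend.2
    simp only [hxs, hys] at tel
    have tel' := congrArg (fun z => κ * z) tel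
    simp only [Finset.mul_sum] at tel'
    refine Eq.trans ?_ (Eq.trans tel' ?_)
    · apply Finset.sum_congr rfl
      intro t ht
      rw [Finset.mem_range] at ht
      by_cases had : Ad T (lev ℓ i N t)
      · rw [if_pos had, hL t had, if_pos (show _ ∧ _ from had), prod_three _ ht, hgt, mul_left_comm]
        congr 3
        · congr 1
          · apply Finset.prod_congr rfl
            intro s hs
            rw [Finset.mem_range] at hs
            rw [if_neg (by omega), if_neg (by omega)]
            simp only [add_zero, sub_zero]
          · simp only [lt_irrefl, le_refl, if_true, if_false, add_zero, sub_zero]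
        · apply Finset.prod_congr rfl
          intro s hs
          rw [Finset.mem_Ico] at hs
          rw [if_pos (by omega), if_pos (by omega)]
      · rw [if_neg had, if_neg (show ¬ (_ ∧ _) from had), mul_zero]
    · apply Finset.sum_congr rfl
      intro t ht
      rw [Finset.mem_range] at ht
      by_cases had : Rm S (lev ℓ i N t)
      · rw [if_pos had, hR t had, if_pos (show _ ∧ _ from had), prod_three _ ht, hgt, mul_left_comm]
        congr 3
        · congr 1
          · apply Finset.prod_congr rfl
            intro s hs
            rw [Finset.mem_range] at hs
            rw [if_neg (show ¬ t < s by omega), if_neg (show ¬ t ≤ s by omega),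
              if_neg (show ¬ s = t by omega), if_neg (show ¬ s = t by omega)]
            simp only [add_zero, sub_zero]
          · simp only [lt_irrefl, le_refl, if_true, if_false, add_zero, sub_zero]
        · apply Finset.prod_congr rfl
          intro s hs
          rw [Finset.mem_Ico] at hs
          rw [if_pos (show t < s by omega), if_pos (show t ≤ s by omega),
              if_neg (show ¬ s = t by omega), if_neg (show ¬ s = t by omega)]
      · rw [if_neg had, if_neg (show ¬ (_ ∧ _) from had), mul_zero]
  · have e1 : lev ℓ i N (2 * N) - ℓ = lev ℓ i N (2 * N - 1) := by
      rw [← hxs (2 * N - 1), Nat.sub_add_cancel (by omega)]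
    have e2 : lev ℓ i N (2 * N) + 1 - ℓ = lev ℓ i N (2 * N - 1) + 1 := by
      rw [← hys (2 * N - 1), Nat.sub_add_cancel (by omega)]
    rw [e1, e2] at hend
    rw [Finset.sum_eq_zero, Finset.sum_eq_zero]
    · intro t ht
      rw [Finset.mem_range] at ht
      split_ifs with had
      · rw [hR t had, Finset.prod_eq_zero (i := 2 * N - 1) (Finset.mem_range.2 (by omega)), mul_zero,
          mul_zero]
        have hne : ¬ (2 * N - 1 = t) := by
          rintro rfl
          have h1 := had.2
          rw [hzS _ (by omega)] at h1
          omega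
        rw [if_neg hne, if_neg hne, hzS _ hlast, hzS _ (by omega), if_pos (show t ≤ 2 * N - 1 by omega)]
        unfold om
        rw [if_neg]
        rintro ⟨_, _, h3, h4⟩
        apply hend
        constructor <;> omega
      · rfl
    · intro t ht
      rw [Finset.mem_range] at ht
      split_ifs with had
      · rw [hL t had, Finset.prod_eq_zero (i := 2 * N - 1) (Finset.mem_range.2 (by omega)), mul_zero,
          mul_zero]
        rw [hzS _ hlast, hzS _ (by omega), if_pos (show t ≤ 2 * N - 1 by omega)]
        unfold om
        rw [if_neg]
        rintro ⟨_, _, h3, h4⟩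
        apply hend
        constructor <;> omega
      · rfl

/-! ### Part 8: construction of highest weight vectors -/

/-- iterated transfer operators applied to the vacuum -/
noncomputable def phi (ℓ N : ℕ) : List ℕ → YoungDiagram → RatFunc ℚ
  | [], U => if U.card = 0 then 1 else 0
  | k :: ks, U => if U.card = ℓ * (k + ks.sum) then
      ∑ S ∈ ydn (ℓ * ks.sum), W ℓ N S U * phi ℓ N ks S else 0

theorem phi_supp {ℓ N : ℕ} {l : List ℕ} {U : YoungDiagram} (h : phi ℓ N l U ≠ 0) :
    U.card = ℓ * l.sum := by
  cases l with
  | nil =>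
    rw [phi] at h
    split_ifs at h with h1
    · simpa using h1
    · simp at h
  | cons k ks =>
    rw [phi] at h
    split_ifs at h with h1
    · simpa using h1
    · simp at h

/-- the vector with coordinates `phi` -/
noncomputable def phiF (ℓ N : ℕ) (l : List ℕ) : Fock :=
  Finsupp.onFinset (ydn (ℓ * l.sum)) (phi ℓ N l) (fun _ h => mem_ydn.2 (phi_supp h))

theorem phiF_apply (ℓ N : ℕ) (l : List ℕ) (U : YoungDiagram) : phiF ℓ N l U = phi ℓ N l U := rfl

theorem reindex {M : ℕ} (c : ℤ) (f : YoungDiagram → RatFunc ℚ) :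
    ∑ S ∈ (ydn M).filter (fun S => Rm S c), f S =
      ∑ S ∈ (ydn (M - 1)).filter (fun S => Ad S c ∧ S.card + 1 = M), f (up S c) := by
  refine Finset.sum_bij' (fun S _ => dn S c) (fun S _ => up S c) ?_ ?_ ?_ ?_ ?_
  · intro S hS
    rw [Finset.mem_filter, mem_ydn] at hS
    obtain ⟨μ, b, hc, rfl⟩ := rm_iff.1 hS.2
    have h1 := cov_card hc
    rw [dn_eq hc, Finset.mem_filter, mem_ydn]
    exact ⟨by omega, ad_iff.2 ⟨S, b, hc, rfl⟩, by omega⟩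
  · intro S hS
    rw [Finset.mem_filter, mem_ydn] at hS
    obtain ⟨μ, b, hc, rfl⟩ := ad_iff.1 hS.2.1
    have h1 := cov_card hc
    rw [up_eq hc, Finset.mem_filter, mem_ydn]
    exact ⟨by omega, rm_iff.2 ⟨S, b, hc, rfl⟩⟩
  · intro S hS
    rw [Finset.mem_filter] at hS
    obtain ⟨μ, b, hc, rfl⟩ := rm_iff.1 hS.2
    rw [dn_eq hc, up_eq hc]
  · intro S hS
    rw [Finset.mem_filter] at hS
    obtain ⟨μ, b, hc, rfl⟩ := ad_iff.1 hS.2.1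
    rw [up_eq hc, dn_eq hc]
  · intro S hS
    rw [Finset.mem_filter] at hS
    obtain ⟨μ, b, hc, rfl⟩ := rm_iff.1 hS.2
    rw [dn_eq hc, up_eq hc]

theorem hgt_up {ℓ : ℕ} (hℓ : 2 ≤ ℓ) {i : ZMod ℓ} {N t : ℕ} {S : YoungDiagram}
    (h : Ad S (lev ℓ i N t)) : hgt ℓ i N (up S (lev ℓ i N t)) t = hgt ℓ i N S t := by
  obtain ⟨ν, b, hc, hb⟩ := ad_iff.1 h
  rw [← hb, up_eq hc, hgt_cov hℓ hc hb]; simp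

theorem dn_up {S : YoungDiagram} {c : ℤ} (h : Ad S c) : dn (up S c) c = S := by
  obtain ⟨ν, b, hc, rfl⟩ := ad_iff.1 h
  rw [up_eq hc, dn_eq hc]

theorem up_card {S : YoungDiagram} {c : ℤ} (h : Ad S c) : (up S c).card = S.card + 1 := by
  obtain ⟨ν, b, hc, rfl⟩ := ad_iff.1 h
  rw [up_eq hc, cov_card hc]

theorem phiF_hw {ℓ : ℕ} (hℓ : 2 ≤ ℓ) (i : ZMod ℓ) {N : ℕ} (l : List ℕ) (hN : ℓ * l.sum + 3 ≤ N) :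
    Eop ℓ i (phiF ℓ N l) = 0 := by
  induction l with
  | nil =>
    ext U
    rw [Eop_apply hℓ i (N := U.card + 1) _ _ (by omega), Finset.sum_eq_zero]
    · rfl
    · intro t _
      split_ifs with had
      · rw [phiF_apply, phi, if_neg (by rw [up_card had]; omega), mul_zero]
      · rfl
  | cons k ks ih =>
    rw [List.sum_cons] at hN
    have hM : ℓ * ks.sum ≤ ℓ * (k + ks.sum) := Nat.mul_le_mul_left _ (by omega)
    specialize ih (by omega)
    ext U
    rw [Finsupp.zero_apply]
    by_cases hU : U.card + 1 = ℓ * (k + ks.sum)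
    · rw [Eop_apply hℓ i (N := N) _ _ (by omega)]
      have e1 : ∀ t ∈ Finset.range (2 * N), (if Ad U (lev ℓ i N t) then
          v ^ (hgt ℓ i N U t) * phiF ℓ N (k :: ks) (up U (lev ℓ i N t)) else 0) =
          ∑ S ∈ ydn (ℓ * ks.sum), phi ℓ N ks S * (if Ad U (lev ℓ i N t) then
            v ^ (hgt ℓ i N U t) * W ℓ N S (up U (lev ℓ i N t)) else 0) := by
        intro t _
        by_cases had : Ad U (lev ℓ i N t)
        · simp only [if_pos had]
          rw [phiF_apply, phi, if_pos (by rw [up_card had]; omega), Finset.mul_sum]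
          apply Finset.sum_congr rfl
          intro S _
          ring
        · simp only [if_neg had]
          simp
      rw [Finset.sum_congr rfl e1, Finset.sum_comm]
      have e2 : ∀ S ∈ ydn (ℓ * ks.sum), ∑ t ∈ Finset.range (2 * N), phi ℓ N ks S *
          (if Ad U (lev ℓ i N t) then
            v ^ (hgt ℓ i N U t) * W ℓ N S (up U (lev ℓ i N t)) else 0) =
          ∑ t ∈ Finset.range (2 * N), (if Rm S (lev ℓ i N t) then phi ℓ N ks S *
            (v ^ (hgt ℓ i N S t) * W ℓ N (dn S (lev ℓ i N t)) U) else 0) := by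
        intro S hS
        rw [mem_ydn] at hS
        rw [← Finset.mul_sum, core hℓ i (n := ℓ * (k + ks.sum)) (by omega) (by omega) (by omega),
          Finset.mul_sum]
        apply Finset.sum_congr rfl
        intro t _
        rw [mul_ite, mul_zero]
      rw [Finset.sum_congr rfl e2, Finset.sum_comm]
      have e3 : ∀ t ∈ Finset.range (2 * N), ∑ S ∈ ydn (ℓ * ks.sum),
          (if Rm S (lev ℓ i N t) then phi ℓ N ks S *
            (v ^ (hgt ℓ i N S t) * W ℓ N (dn S (lev ℓ i N t)) U) else 0) =
          ∑ S ∈ (ydn (ℓ * ks.sum - 1)).filter (fun S => S.card + 1 = ℓ * ks.sum), W ℓ N S U *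
            (if Ad S (lev ℓ i N t) then v ^ (hgt ℓ i N S t) * phiF ℓ N ks (up S (lev ℓ i N t))
              else 0) := by
        intro t _
        rw [← Finset.sum_filter, reindex]
        simp only [mul_ite, mul_zero]
        rw [← Finset.sum_filter, Finset.filter_filter]
        apply Finset.sum_congr
        · ext S
          simp only [Finset.mem_filter]
          tauto
        · intro S hS
          rw [Finset.mem_filter] at hS
          rw [hgt_up hℓ hS.2.2, dn_up hS.2.2, phiF_apply]
          ring
      rw [Finset.sum_congr rfl e3, Finset.sum_comm]
      apply Finset.sum_eq_zero
      intro S hS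
      rw [Finset.mem_filter, mem_ydn] at hS
      rw [← Finset.mul_sum, ← Eop_apply hℓ i (N := N) (phiF ℓ N ks) S (by omega), ih]
      simp
    · rw [Eop_apply hℓ i (N := U.card + 1) _ _ (by omega), Finset.sum_eq_zero]
      intro t _
      split_ifs with had
      · rw [phiF_apply, phi, if_neg (by rw [up_card had]; omega), mul_zero]
      · rfl

theorem phiF_mem {ℓ : ℕ} (hℓ : 2 ≤ ℓ) {N : ℕ} (l : List ℕ) (hN : ℓ * l.sum + 3 ≤ N) :
    phiF ℓ N l ∈ HW ℓ (ℓ * l.sum) := by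
  rw [mem_HW, mem_degComp]
  refine ⟨?_, fun i => phiF_hw hℓ i l hN⟩
  intro U hU
  rw [phiF_apply]
  by_contra h
  exact hU (phi_supp h)

theorem sum_c_occ {μ : YoungDiagram} {n : ℕ} {L : ℤ} (h : μ.card ≤ n) (hL : (n : ℤ) ≤ L) :
    ∑ c ∈ Finset.Ioc (-n : ℤ) L, c * occ μ c = μ.card - ∑ j ∈ Finset.range n, (j : ℤ) := by
  have h0 : μ.rowLen n = 0 := by
    have := @rowLen_le_card μ n
    omega
  have h1 := @rowLen_le_card μ 0
  rw [sum_occ (fun c => c) h0 (by omega), card_eq_sum h0]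
  unfold beta
  rw [Finset.sum_sub_distrib]
  push_cast
  rfl

theorem sum_one_occ {μ : YoungDiagram} {n : ℕ} {L : ℤ} (h : μ.card ≤ n) (hL : (n : ℤ) ≤ L) :
    ∑ c ∈ Finset.Ioc (-n : ℤ) L, occ μ c = n := by
  have h0 : μ.rowLen n = 0 := by
    have := @rowLen_le_card μ n
    omega
  have h1 := @rowLen_le_card μ 0
  have := sum_occ (fun _ => 1) h0 (L := L) (by omega)
  simpa using this

theorem sum_shift (f : ℤ → ℤ) (a b d : ℤ) :
    ∑ c ∈ Finset.Ioc a b, f (c - d) = ∑ c ∈ Finset.Ioc (a - d) (b - d), f c := by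
  refine Finset.sum_bij' (fun c _ => c - d) (fun c _ => c + d) ?_ ?_ ?_ ?_ ?_
  · intro c hc; rw [Finset.mem_Ioc] at *; omega
  · intro c hc; rw [Finset.mem_Ioc] at *; omega
  · intro c hc; simp
  · intro c hc; simp
  · intro c hc; rfl

theorem energy {ℓ : ℕ} (hℓ : 2 ≤ ℓ) {n N : ℕ} (hN : n ≤ N) {S U : YoungDiagram}
    (hS : S.card ≤ n) (hU : U.card ≤ n) (hX : ∀ c, 0 ≤ fl ℓ N S U c ∧ fl ℓ N S U c ≤ occ S c) :
    (U.card : ℤ) - S.card = ℓ * ∑ c ∈ Finset.Ioc (-n : ℤ) n, fl ℓ N S U c := by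
  have hhigh : ∀ c, (n : ℤ) < c → fl ℓ N S U c = 0 := by
    intro c hc
    have := hX c
    rw [occ_high_card hS hc] at this
    omega
  have hlow : ∀ c, c ≤ -(n : ℤ) → fl ℓ N S U c = 0 := fun c hc => fl_low hℓ hN hS hU hc
  have h1 := sum_c_occ (μ := U) (n := n) (L := n + ℓ) hU (by omega)
  have h2 := sum_c_occ (μ := S) (n := n) (L := n + ℓ) hS (by omega)
  have h3 : (U.card : ℤ) - S.card = ∑ c ∈ Finset.Ioc (-n : ℤ) (n + ℓ),
      (((c - ℓ) + ℓ) * fl ℓ N S U (c - ℓ) - c * fl ℓ N S U c) := by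
    have e : (U.card : ℤ) - S.card = ∑ c ∈ Finset.Ioc (-n : ℤ) (n + ℓ), c * occ U c -
      ∑ c ∈ Finset.Ioc (-n : ℤ) (n + ℓ), c * occ S c := by rw [h1, h2]; ring
    rw [e, ← Finset.sum_sub_distrib]
    apply Finset.sum_congr rfl
    intro c _
    have := fl_rec hℓ hN hS hU c
    rw [this]
    ring
  rw [h3, Finset.sum_sub_distrib, sum_shift (fun c => (c + ℓ) * fl ℓ N S U c)]
  have h4 : ∑ c ∈ Finset.Ioc (-(n : ℤ) - ℓ) (n + ℓ - ℓ), (c + ℓ) * fl ℓ N S U c =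
      ∑ c ∈ Finset.Ioc (-(n : ℤ)) n, (c + ℓ) * fl ℓ N S U c := by
    symm
    apply Finset.sum_subset
    · intro c hc
      rw [Finset.mem_Ioc] at *
      omega
    · intro c hc hc'
      rw [Finset.mem_Ioc] at *
      rw [hlow c (by omega), mul_zero]
  have h5 : ∑ c ∈ Finset.Ioc (-(n : ℤ)) (n + ℓ), c * fl ℓ N S U c =
      ∑ c ∈ Finset.Ioc (-(n : ℤ)) n, c * fl ℓ N S U c := by
    symm
    apply Finset.sum_subset
    · intro c hc
      rw [Finset.mem_Ioc] at *
      omega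
    · intro c hc hc'
      rw [Finset.mem_Ioc] at *
      rw [hhigh c (by omega), mul_zero]
  rw [h4, h5, ← Finset.sum_sub_distrib, Finset.mul_sum]
  apply Finset.sum_congr rfl
  intro c _
  ring

theorem tri {ℓ : ℕ} (hℓ : 2 ≤ ℓ) {n N : ℕ} (hN : n ≤ N) {S U : YoungDiagram} {k k' : ℕ}
    (hU : U.card ≤ n) (hcard : U.card = S.card + ℓ * k)
    (hr : U.rowLen k' = 0) (hk : k' ≤ k) (hW : W ℓ N S U ≠ 0) :
    k' = k ∧ ∀ c, occ S c = if c ≤ -(k : ℤ) then 1 else occ U (c + ℓ) := by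
  have hS : S.card ≤ n := by omega
  have hkn : k ≤ n := by nlinarith
  have hX : ∀ c, 0 ≤ fl ℓ N S U c ∧ fl ℓ N S U c ≤ occ S c := by
    by_contra hc
    apply hW
    unfold W Gw
    rw [if_neg]
    exact hc
  have hen := energy hℓ hN hS hU hX
  have hrec := fl_rec hℓ hN hS hU
  have hsum : ∑ c ∈ Finset.Ioc (-n : ℤ) n, fl ℓ N S U c = k := by
    have h1 : (ℓ : ℤ) * k = ℓ * ∑ c ∈ Finset.Ioc (-n : ℤ) n, fl ℓ N S U c := by
      rw [← hen, hcard]; push_cast; ring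
    exact (mul_left_cancel₀ (by omega) h1).symm
  have hlow : ∀ c, c ≤ -(k' : ℤ) → fl ℓ N S U c = 0 := by
    intro c hc
    obtain ⟨m, hm⟩ : ∃ m : ℕ, (c + n).toNat = m := ⟨_, rfl⟩
    induction m using Nat.strong_induction_on generalizing c with
    | _ m ih =>
    by_cases hc' : c ≤ -n
    · exact fl_low hℓ hN hS hU hc'
    · have h1 := hrec c
      rw [ih (c - ℓ + n).toNat (by omega) (c - ℓ) (by omega) rfl, occ_low hr hc] at h1
      have h2 := hX c
      have h3 := occ_bit S c
      omega
  have hSlow : ∀ c, c ≤ -(k' : ℤ) → occ S c = 1 := by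
    intro c hc
    have h1 := hrec c
    rw [hlow c hc, hlow (c - ℓ) (by omega), occ_low hr hc] at h1
    omega
  have hunion : Finset.Ioc (-n : ℤ) n = Finset.Ioc (-n : ℤ) (-k') ∪ Finset.Ioc (-k' : ℤ) n := by
    rw [Finset.Ioc_union_Ioc_eq_Ioc] <;> omega
  have hdisj : Disjoint (Finset.Ioc (-n : ℤ) (-k')) (Finset.Ioc (-k' : ℤ) n) := by
    rw [Finset.disjoint_left]
    intro c h1 h2
    rw [Finset.mem_Ioc] at *
    omega
  have hS1 : ∑ c ∈ Finset.Ioc (-k' : ℤ) n, occ S c = k' := by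
    have h1 := sum_one_occ (μ := S) (n := n) (L := n) hS le_rfl
    rw [hunion, Finset.sum_union hdisj] at h1
    have h2 : ∑ c ∈ Finset.Ioc (-n : ℤ) (-k'), occ S c = n - k' := by
      rw [Finset.sum_congr rfl (g := fun _ => 1)]
      · simp; omega
      · intro c hc
        rw [Finset.mem_Ioc] at hc
        exact hSlow c hc.2
    linarith
  have hX1 : ∑ c ∈ Finset.Ioc (-k' : ℤ) n, fl ℓ N S U c = k := by
    rw [hunion, Finset.sum_union hdisj] at hsum
    rw [Finset.sum_eq_zero (s := Finset.Ioc (-n : ℤ) (-k'))] at hsum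
    · linarith
    · intro c hc
      rw [Finset.mem_Ioc] at hc
      exact hlow c hc.2
  have hle : ∑ c ∈ Finset.Ioc (-k' : ℤ) n, fl ℓ N S U c ≤ ∑ c ∈ Finset.Ioc (-k' : ℤ) n, occ S c :=
    Finset.sum_le_sum (fun c _ => (hX c).2)
  have hkk : k' = k := by omega
  refine ⟨hkk, ?_⟩
  have heq := (Finset.sum_eq_sum_iff_of_le (fun c _ => (hX c).2)).1
    (show ∑ c ∈ Finset.Ioc (-k' : ℤ) n, fl ℓ N S U c = ∑ c ∈ Finset.Ioc (-k' : ℤ) n, occ S c by omega)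
  have heq' : ∀ c, -(k' : ℤ) < c → fl ℓ N S U c = occ S c := by
    intro c hc
    by_cases h : c ≤ n
    · exact heq c (Finset.mem_Ioc.2 ⟨hc, h⟩)
    · have h1 := hX c
      rw [occ_high_card hS (by omega)] at *
      omega
  intro c
  split_ifs with h
  · exact hSlow c (by omega)
  · have h1 := hrec (c + ℓ)
    rw [add_sub_cancel_right, heq' c (by omega), heq' (c + ℓ) (by omega)] at h1
    omega

theorem T_cons_rowLen {ℓ k : ℕ} {ks : List ℕ} (h : ∀ x ∈ ks, x ≤ k) :
    (T ℓ ks).rowLen k = 0 ∧ (T ℓ (k :: ks)).rowLen k = 0 ∧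
    ∀ j, j < k → (T ℓ (k :: ks)).rowLen j = (T ℓ ks).rowLen j + ℓ := by
  have h1 : (T ℓ ks).rowLen k = 0 := by
    rw [T_rowLen, List.countP_eq_zero.2, mul_zero]
    intro x hx
    simpa using h x hx
  refine ⟨h1, ?_, ?_⟩
  · rw [T_rowLen, List.countP_cons_of_neg (by simp), ← T_rowLen, h1]
  · intro j hj
    rw [T_rowLen, T_rowLen, List.countP_cons_of_pos (by simpa using hj)]
    ring

theorem T_cons_occ {ℓ k : ℕ} {ks : List ℕ} (h : ∀ x ∈ ks, x ≤ k) (c : ℤ) :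
    occ (T ℓ ks) c = if c ≤ -(k : ℤ) then 1 else occ (T ℓ (k :: ks)) (c + ℓ) := by
  obtain ⟨h1, h2, h3⟩ := T_cons_rowLen (ℓ := ℓ) h
  split_ifs with hc
  · exact occ_low h1 hc
  · have key : (∃ j, beta (T ℓ ks) j = c) ↔ ∃ j, beta (T ℓ (k :: ks)) j = c + ℓ := by
      constructor
      · rintro ⟨j, hj⟩
        have hjk : j < k := by
          by_contra hh
          have := (T ℓ ks).rowLen_anti k j (by omega)
          unfold beta at hj
          omega
        refine ⟨j, ?_⟩
        unfold beta at *
        rw [h3 j hjk]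
        push_cast
        omega
      · rintro ⟨j, hj⟩
        have hjk : j < k := by
          by_contra hh
          have := (T ℓ (k :: ks)).rowLen_anti k j (by omega)
          unfold beta at hj
          omega
        refine ⟨j, ?_⟩
        unfold beta at *
        rw [h3 j hjk] at hj
        push_cast at hj
        omega
    unfold occ
    simp only [key]

theorem W_one {ℓ : ℕ} (hℓ : 2 ≤ ℓ) {n N k : ℕ} {ks : List ℕ} (h : ∀ x ∈ ks, x ≤ k)
    (hn : ℓ * (k + ks.sum) ≤ n) (hN : n ≤ N) : W ℓ N (T ℓ ks) (T ℓ (k :: ks)) = 1 := by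
  obtain ⟨h1, h2, h3⟩ := T_cons_rowLen (ℓ := ℓ) h
  have hkn : k ≤ n := by
    have h4 : 1 * (k + ks.sum) ≤ ℓ * (k + ks.sum) := Nat.mul_le_mul_right _ (by omega)
    omega
  have hS : (T ℓ ks).card ≤ n := by rw [T_card]; nlinarith
  have hU : (T ℓ (k :: ks)).card ≤ n := by rw [T_card, List.sum_cons]; exact hn
  have hX : ∀ c, fl ℓ N (T ℓ ks) (T ℓ (k :: ks)) c =
      if c ≤ -(k : ℤ) then 0 else occ (T ℓ ks) c := by
    refine flow_unique hℓ (D := fun c => occ (T ℓ ks) c - occ (T ℓ (k :: ks)) c) ?_ ?_ ?_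
    · intro c hc
      rw [occ_low h1 (by omega), occ_low h2 (by omega), sub_self]
    · intro c hc
      rw [if_pos (by omega)]
    · intro c
      by_cases hc : c ≤ -(k : ℤ)
      · rw [if_pos hc, if_pos (by omega), occ_low h1 hc, occ_low h2 hc]; rfl
      · rw [if_neg hc]
        by_cases hc2 : c - ℓ ≤ -(k : ℤ)
        · rw [if_pos hc2]
          have : occ (T ℓ (k :: ks)) c = 0 := by
            rw [occ_zero]
            rintro ⟨j, hj⟩
            by_cases hjk : j < k
            · unfold beta at hj
              rw [h3 j hjk] at hj
              push_cast at hj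
              omega
            · have := (T ℓ (k :: ks)).rowLen_anti k j (by omega)
              unfold beta at hj
              omega
          rw [this]; ring
        · rw [if_neg hc2, T_cons_occ h (c - ℓ), if_neg hc2, sub_add_cancel]; ring
  have hW : W ℓ N (T ℓ ks) (T ℓ (k :: ks)) = Gw ℓ N (occ (T ℓ ks)) (fl ℓ N (T ℓ ks) (T ℓ (k :: ks))) :=
    rfl
  rw [hW]
  unfold Gw
  rw [if_pos]
  · rw [Finset.sum_eq_zero, zpow_zero]
    intro m _
    by_cases hm : m ≤ -(k : ℤ)
    · rw [Finset.sum_eq_zero, mul_zero]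
      intro c hc
      rw [Finset.mem_Ico] at hc
      rw [hX, if_pos (by omega)]
    · rw [hX, if_neg hm, sub_self, zero_mul]
  · intro c
    rw [hX]
    have := occ_bit (T ℓ ks) c
    split_ifs <;> omega

theorem phi_lt {ℓ : ℕ} (hℓ : 2 ≤ ℓ) {N k k' : ℕ} {ks ks' : List ℕ} (h' : ∀ x ∈ ks', x ≤ k')
    (hN : ℓ * (k + ks.sum) ≤ N) (hk : k' < k) : phi ℓ N (k :: ks) (T ℓ (k' :: ks')) = 0 := by
  rw [phi]
  split_ifs with hc
  · apply Finset.sum_eq_zero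
    intro S hS
    rw [mem_ydn] at hS
    by_contra hne
    have hW := left_ne_zero_of_mul hne
    have := (tri hℓ hN (S := S) (k := k) (k' := k') hc.le (by rw [hc, hS]; ring)
      (T_cons_rowLen h').2.1 hk.le hW).1
    omega
  · rfl

theorem phi_eq {ℓ : ℕ} (hℓ : 2 ≤ ℓ) {N k : ℕ} {ks ks' : List ℕ} (h' : ∀ x ∈ ks', x ≤ k)
    (hN : ℓ * (k + ks.sum) ≤ N) (hs : ks.sum = ks'.sum) :
    phi ℓ N (k :: ks) (T ℓ (k :: ks')) = phi ℓ N ks (T ℓ ks') := by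
  have hc : (T ℓ (k :: ks')).card = ℓ * (k + ks.sum) := by rw [T_card, List.sum_cons, hs]
  rw [phi, if_pos hc, Finset.sum_eq_single (T ℓ ks')]
  · rw [W_one hℓ h' (n := N) (by rw [← hs]; exact hN) le_rfl, one_mul]
  · intro S hS hne
    rw [mem_ydn] at hS
    by_contra hne'
    have hW := left_ne_zero_of_mul hne'
    have h1 := (tri hℓ hN (S := S) (k := k) (k' := k) hc.le (by rw [hc, hS]; ring)
      (T_cons_rowLen h').2.1 le_rfl hW).2
    apply hne
    apply occ_inj
    intro c
    rw [h1, T_cons_occ h']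
  · intro hh
    exfalso
    apply hh
    rw [mem_ydn, T_card, hs]

theorem phi_self {ℓ : ℕ} (hℓ : 2 ≤ ℓ) {N : ℕ} {l : List ℕ} (h : l.Pairwise (· ≥ ·))
    (hN : ℓ * l.sum ≤ N) : phi ℓ N l (T ℓ l) = 1 := by
  induction l with
  | nil =>
    rw [phi, if_pos]
    rw [T_card]; simp
  | cons k ks ih =>
    rw [List.pairwise_cons] at h
    rw [List.sum_cons] at hN
    rw [phi_eq hℓ h.1 hN rfl]
    exact ih h.2 (le_trans (Nat.mul_le_mul_left _ (by omega)) hN)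

theorem phi_lex {ℓ : ℕ} (hℓ : 2 ≤ ℓ) {N : ℕ} {l l' : List ℕ} (h' : l'.Pairwise (· ≥ ·))
    (hp : ∀ x ∈ l, 0 < x) (hp' : ∀ x ∈ l', 0 < x) (hs : l.sum = l'.sum)
    (hN : ℓ * l.sum ≤ N) (hne : phi ℓ N l (T ℓ l') ≠ 0) : l = l' ∨ l < l' := by
  induction l generalizing l' with
  | nil =>
    cases l' with
    | nil => exact Or.inl rfl
    | cons k' ks' =>
      have := hp' k' (by simp)
      rw [List.sum_nil, List.sum_cons] at hs
      omega
  | cons k ks ih =>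
    cases l' with
    | nil =>
      have := hp k (by simp)
      rw [List.sum_nil, List.sum_cons] at hs
      omega
    | cons k' ks' =>
      rw [List.pairwise_cons] at h'
      rw [List.sum_cons] at hN
      rw [List.sum_cons, List.sum_cons] at hs
      rcases lt_trichotomy k k' with hk | rfl | hk
      · right
        rw [List.cons_lt_cons_iff]
        exact Or.inl hk
      · rw [phi_eq hℓ h'.1 hN (by omega)] at hne
        rcases ih h'.2 (fun x hx => hp x (by simp [hx])) (fun x hx => hp' x (by simp [hx]))
          (by omega) (le_trans (Nat.mul_le_mul_left _ (by omega)) hN) hne with h | h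
        · left; rw [h]
        · right
          rw [List.cons_lt_cons_iff]
          exact Or.inr ⟨rfl, h⟩
      · exact absurd (phi_lt hℓ h'.1 hN hk) hne

theorem plist_sorted {m : ℕ} (p : Nat.Partition m) : (plist p).Pairwise (· ≥ ·) := by
  unfold plist
  exact Multiset.pairwise_sort _ _

theorem plist_pos {m : ℕ} (p : Nat.Partition m) : ∀ x ∈ plist p, 0 < x := by
  intro x hx
  apply p.parts_pos
  rw [← plist_coe]
  simpa using hx

theorem plist_inj {m : ℕ} {p q : Nat.Partition m} (h : plist p = plist q) : p = q := by
  apply Nat.Partition.ext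
  rw [← plist_coe, ← plist_coe, h]

/-- linear combinations of vectors in a submodule of Fock space -/
noncomputable def comb {ι : Type} [Fintype ι] {V : Submodule (RatFunc ℚ) Fock} {f : ι → Fock}
    (h : ∀ p, f p ∈ V) : (ι → RatFunc ℚ) →ₗ[RatFunc ℚ] V where
  toFun g := ⟨∑ p, g p • f p, Submodule.sum_mem _ (fun p _ => V.smul_mem _ (h p))⟩
  map_add' x y := by
    apply Subtype.ext
    simp only [Pi.add_apply, add_smul, Finset.sum_add_distrib, Submodule.coe_add]
  map_smul' c x := by
    apply Subtype.ext
    simp only [Pi.smul_apply, smul_eq_mul, mul_smul, Finset.smul_sum, Submodule.coe_smul,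
      RingHom.id_apply]

theorem HW_ge {ℓ : ℕ} (hℓ : 2 ≤ ℓ) (m : ℕ) :
    Fintype.card (Nat.Partition m) ≤ Module.finrank (RatFunc ℚ) (HW ℓ (ℓ * m)) := by
  have := HW_finite hℓ m
  have hmem : ∀ p : Nat.Partition m, phiF ℓ (ℓ * m + 3) (plist p) ∈ HW ℓ (ℓ * m) := by
    intro p
    have := phiF_mem hℓ (N := ℓ * m + 3) (plist p) (by rw [plist_sum])
    rwa [plist_sum] at this
  have hinj : Function.Injective (comb hmem) := by
    rw [injective_iff_map_eq_zero]
    intro g hg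
    by_contra hne0
    have hne : ∃ p, g p ≠ 0 := Function.ne_iff.1 hne0
    have hg' : ∑ p, g p • phiF ℓ (ℓ * m + 3) (plist p) = 0 := congrArg Subtype.val hg
    obtain ⟨p0, hp0, hmin⟩ := Finset.exists_min_image
      (Finset.univ.filter (fun p : Nat.Partition m => g p ≠ 0)) plist
      (by obtain ⟨p, hp⟩ := hne; exact ⟨p, by simpa using hp⟩)
    rw [Finset.mem_filter] at hp0
    have hev := congrArg (fun z : Fock => z (T ℓ (plist p0))) hg'
    simp only [Finsupp.finsetSum_apply, Finsupp.smul_apply, smul_eq_mul, Finsupp.zero_apply] at hev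
    rw [Finset.sum_eq_single p0] at hev
    · rw [phiF_apply, phi_self hℓ (plist_sorted p0) (by rw [plist_sum]; omega), mul_one] at hev
      exact hp0.2 hev
    · intro p _ hpne
      by_contra hh
      have h1 := left_ne_zero_of_mul hh
      have h2 := right_ne_zero_of_mul hh
      rw [phiF_apply] at h2
      have h3 := hmin p (by simpa using h1)
      rcases phi_lex hℓ (plist_sorted p0) (plist_pos p) (plist_pos p0)
        (by rw [plist_sum, plist_sum]) (by rw [plist_sum]; omega) h2 with h | h
      · exact hpne (plist_inj h)
      · exact absurd h3 (not_le.2 h)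
    · intro hh
      exact absurd (Finset.mem_univ _) hh
  have := LinearMap.finrank_le_finrank_of_injective hinj
  rwa [Module.finrank_fintype_fun_eq_card] at this

theorem stmt14 (ℓ : ℕ) (hℓ : 2 ≤ ℓ) (n : ℕ) :
    Module.finrank (RatFunc ℚ)
        ↥(degComp n ⊓ ⨅ i : ZMod ℓ, LinearMap.ker (Eop ℓ i))
      = if ℓ ∣ n then Fintype.card (Nat.Partition (n / ℓ)) else 0 := by
  change Module.finrank (RatFunc ℚ) ↥(HW ℓ n) = _
  split_ifs with h
  · obtain ⟨m, rfl⟩ := h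
    rw [Nat.mul_div_cancel_left m (by omega)]
    exact le_antisymm (HW_le hℓ m) (HW_ge hℓ m)
  · rw [HW_bot hℓ h]
    exact finrank_bot _ _

end MisraMiwa
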